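/- arXiv:1501.07340 — 10 statements merged into one kernel-verified Lean document; each statement's English description precedes it below -/
import Mathlib

section
/- Let n ≥ 1, let X be a nonempty set, and for each t = 1,…,n let X_t : (X × {0,1})^{t-1} → 2^X be constraint maps taking nonempty values. Let F be a nonempty class of functions X → [0,1] and fix δ ∈ (0,1/2). Then V_n(F^δ) ≤ sup_{x,μ,p} E_y sup_{f ∈ F^δ} [ Σ_{t : p_t(y) ∈ [δ,1−δ]} η(p_t(y), y_t)·(μ_t(y) − f(x_t(y))) − (1/2)·(μ_t(y) − f(x_t(y)))² ] + 2 n δ log(1/δ), where μ and p range over all [0,1]-valued trees of depth n, x ranges over all X-valued trees of depth n that are consistent with the constraint maps X_t, and E_y denotes expectation over y ∈ {0,1}^n drawn from the process y_t | y_1,…,y_{t−1} ∼ Bernoulli(p_t(y_1,…,y_{t−1})). -/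
open scoped Classical

noncomputable section

/-- The logarithmic (self-information) loss, valued in the extended reals. -/
def logLoss (a : ℝ) (y : Bool) : EReal :=
  if y then (if a = 0 then ⊤ else ((-Real.log a : ℝ) : EReal))
  else (if a = 1 then ⊤ else ((-Real.log (1 - a) : ℝ) : EReal))

variable {X : Type*}

/-- Cumulative loss of the expert `f` on the history `h`, in the extended reals. -/
def cumLoss (f : X → ℝ) : List (X × Bool) → EReal
  | [] => 0
  | (x, b) :: h => logLoss (f x) b + cumLoss f h

/-- The value, by backward recursion, of the remaining `m` rounds of the sequential
probability assignment game with expert class `F` and constraint maps `XC`, given the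
history `h`: at each round Nature picks `x ∈ XC h`, the forecaster picks `ŷ ∈ [0,1]`,
Nature picks `p ∈ [0,1]`, `y ∼ Bernoulli(p)`, the forecaster incurs `ℓ(ŷ,y)`, and at the
end the benchmark `inf_{f∈F}` cumulative loss is subtracted. -/
def gval (F : Set (X → ℝ)) (XC : List (X × Bool) → Set X) :
    ℕ → List (X × Bool) → EReal
  | 0, h => -⨅ f ∈ F, cumLoss f h
  | (m + 1), h =>
      ⨆ x ∈ XC h, ⨅ yhat ∈ Set.Icc (0 : ℝ) 1, ⨆ p ∈ Set.Icc (0 : ℝ) 1,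
        ((p : EReal) * (logLoss yhat true + gval F XC m (h ++ [(x, true)])) +
          (((1 - p : ℝ)) : EReal) * (logLoss yhat false + gval F XC m (h ++ [(x, false)])))

/-- The minimax regret `V_n(F)` of the `n`-round game. -/
def minimaxV (F : Set (X → ℝ)) (XC : List (X × Bool) → Set X) (n : ℕ) : EReal :=
  gval F XC n []

/-- The truncation `[a]_δ`. -/
def trunc (δ a : ℝ) : ℝ := if a < δ then δ else if a > 1 - δ then 1 - δ else a

/-- A `Z`-valued tree of depth `n`, encoded as a function of the whole path, is predictable:
`z_t(y)` depends only on `y_1,…,y_{t−1}`. -/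
def Predictable {Z : Type*} (n : ℕ) (z : (Fin n → Bool) → Fin n → Z) : Prop :=
  ∀ y y' : Fin n → Bool, ∀ t : Fin n, (∀ s : Fin n, s < t → y s = y' s) → z y t = z y' t

/-- The history (list of (side information, outcome) pairs) produced by following the
path `y` in the tree `x` for the first `t` rounds. -/
def histOf (n : ℕ) (x : (Fin n → Bool) → Fin n → X) (y : Fin n → Bool) (t : Fin n) :
    List (X × Bool) :=
  List.ofFn fun s : Fin t.val =>
    (x y ⟨s.val, s.isLt.trans t.isLt⟩, y ⟨s.val, s.isLt.trans t.isLt⟩)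

/-- An `X`-valued tree is consistent with the constraint maps `XC` if on every path each
label belongs to the constraint set determined by the preceding history. -/
def ConsistentTree (n : ℕ) (XC : List (X × Bool) → Set X)
    (x : (Fin n → Bool) → Fin n → X) : Prop :=
  Predictable n x ∧ ∀ (y : Fin n → Bool) (t : Fin n), x y t ∈ XC (histOf n x y t)

/-- `η(p,a) = −1{a=1}/p + 1{a=0}/(1−p)`. -/
def eta (p : ℝ) (a : Bool) : ℝ := if a then -1 / p else 1 / (1 - p)

/-- The probability of the path `y ∈ {0,1}^n` under the process
`y_t | y_1,…,y_{t−1} ∼ Bernoulli(p_t(y_1,…,y_{t−1}))`. -/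
def bweight (n : ℕ) (p : (Fin n → Bool) → Fin n → ℝ) (y : Fin n → Bool) : ℝ :=
  ∏ t : Fin n, (if y t then p y t else 1 - p y t)

/-- The logarithmic loss as a real number. -/
def realLoss (a : ℝ) (b : Bool) : ℝ := if b then -Real.log a else -Real.log (1 - a)

lemma logLoss_eq_coe {a : ℝ} (ha : a ∈ Set.Ioo (0 : ℝ) 1) (b : Bool) :
    logLoss a b = ((realLoss a b : ℝ) : EReal) := by
  cases b <;> simp [logLoss, realLoss, ha.1.ne', ha.2.ne]

lemma logLoss_nonneg {a : ℝ} (ha : a ∈ Set.Icc (0 : ℝ) 1) (b : Bool) : 0 ≤ logLoss a b := by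
  cases b
  · by_cases h : a = 1
    · simp [logLoss, h]
    · have := Real.log_nonpos (x := 1 - a) (by linarith [ha.2]) (by linarith [ha.1])
      simp only [logLoss, h, if_false, Bool.false_eq_true]
      exact_mod_cast (by linarith : (0 : ℝ) ≤ -Real.log (1 - a))
  · by_cases h : a = 0
    · simp [logLoss, h]
    · have := Real.log_nonpos ha.1 ha.2
      simp only [logLoss, h, if_false, if_true]
      exact_mod_cast (by linarith : (0 : ℝ) ≤ -Real.log a)

lemma realLoss_nonneg {a : ℝ} (ha : a ∈ Set.Icc (0 : ℝ) 1) (b : Bool) : 0 ≤ realLoss a b := by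
  cases b
  · simpa [realLoss] using Real.log_nonpos (x := 1 - a) (by linarith [ha.2]) (by linarith [ha.1])
  · simpa [realLoss] using Real.log_nonpos ha.1 ha.2

lemma realLoss_le {δ a : ℝ} (hδ : 0 < δ) (ha : a ∈ Set.Icc δ (1 - δ)) (b : Bool) :
    realLoss a b ≤ -Real.log δ := by
  cases b
  · simpa [realLoss] using Real.log_le_log hδ (by linarith [ha.2] : δ ≤ 1 - a)
  · simpa [realLoss] using Real.log_le_log hδ ha.1

lemma cumLoss_eq_coe {f : X → ℝ} (hf : ∀ z, f z ∈ Set.Ioo (0 : ℝ) 1) (h : List (X × Bool)) :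
    cumLoss f h = (((h.map fun z => realLoss (f z.1) z.2).sum : ℝ) : EReal) := by
  induction h with
  | nil => simp [cumLoss]
  | cons z h ih =>
    obtain ⟨x, b⟩ := z
    simp [cumLoss, ih, logLoss_eq_coe (hf x)]

/-- The conditional expectation of one round against a forecast in `(0,1)`. -/
lemma round_eq_coe {q : ℝ} (hq : q ∈ Set.Ioo (0 : ℝ) 1) (p a b : ℝ) :
    ((p : EReal) * (logLoss q true + (a : EReal)) +
      (((1 - p : ℝ)) : EReal) * (logLoss q false + (b : EReal))) =
    ((p * (-Real.log q + a) + (1 - p) * (-Real.log (1 - q) + b) : ℝ) : EReal) := by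
  rw [logLoss_eq_coe hq, logLoss_eq_coe hq]
  simp [realLoss]

lemma gval_bounds {δ : ℝ} (hδ : δ ∈ Set.Ioo (0 : ℝ) (1 / 2)) {S : Set (X → ℝ)} (hS : S.Nonempty)
    (hSval : ∀ f ∈ S, ∀ z, f z ∈ Set.Icc δ (1 - δ)) {XC : List (X × Bool) → Set X}
    (hXC : ∀ h, (XC h).Nonempty) (m : ℕ) (h : List (X × Bool)) :
    (((h.length + m) * Real.log δ : ℝ) : EReal) ≤ gval S XC m h ∧
      gval S XC m h ≤ ((m * Real.log 2 : ℝ) : EReal) := by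
  have hsub : ∀ f ∈ S, ∀ z, f z ∈ Set.Ioo (0 : ℝ) 1 := fun f hf z =>
    ⟨hδ.1.trans_le (hSval f hf z).1, by linarith [(hSval f hf z).2, hδ.1]⟩
  induction m generalizing h with
  | zero =>
    simp only [gval]
    constructor
    · obtain ⟨f, hf⟩ := hS
      rw [EReal.le_neg, ← EReal.coe_neg]
      refine (iInf₂_le f hf).trans ?_
      rw [cumLoss_eq_coe (hsub f hf)]
      refine EReal.coe_le_coe_iff.2 ?_
      have := List.sum_le_card_nsmul (h.map fun z => realLoss (f z.1) z.2) (-Real.log δ) (by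
        intro r hr
        obtain ⟨z, -, rfl⟩ := List.mem_map.1 hr
        exact realLoss_le hδ.1 (hSval f hf z.1) z.2)
      simpa using this
    · rw [EReal.neg_le, ← EReal.coe_neg]
      refine le_iInf₂ fun f hf => ?_
      rw [cumLoss_eq_coe (hsub f hf)]
      refine EReal.coe_le_coe_iff.2 ?_
      have : 0 ≤ (h.map fun z => realLoss (f z.1) z.2).sum := List.sum_nonneg (by
        intro r hr
        obtain ⟨z, -, rfl⟩ := List.mem_map.1 hr
        exact realLoss_nonneg ⟨(hsub f hf z.1).1.le, (hsub f hf z.1).2.le⟩ z.2)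
      simpa using this
  | succ m ih =>
    simp only [gval]
    constructor
    · obtain ⟨x, hx⟩ := hXC h
      refine le_trans ?_ (le_iSup₂ x hx)
      refine le_iInf₂ fun q hq => le_trans ?_ (le_iSup₂ (1 : ℝ) (by simp))
      have h1 := (ih (h ++ [(x, true)])).1
      have h2 := add_le_add (logLoss_nonneg hq true) h1
      simp only [List.length_append, List.length_singleton, zero_add, sub_self, EReal.coe_zero,
        zero_mul, add_zero, EReal.coe_one, one_mul] at h2 ⊢
      refine le_trans (le_of_eq (congrArg Real.toEReal ?_)) h2
      push_cast
      ring
    · refine iSup₂_le fun x hx => ?_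
      refine (iInf₂_le (1 / 2 : ℝ) (by norm_num)).trans (iSup₂_le fun p hp => ?_)
      obtain ⟨l1, u1⟩ := ih (h ++ [(x, true)])
      obtain ⟨l0, u0⟩ := ih (h ++ [(x, false)])
      lift gval S XC m (h ++ [(x, true)]) to ℝ using
        ⟨(u1.trans_lt (EReal.coe_lt_top _)).ne, ((EReal.bot_lt_coe _).trans_le l1).ne'⟩ with a
      lift gval S XC m (h ++ [(x, false)]) to ℝ using
        ⟨(u0.trans_lt (EReal.coe_lt_top _)).ne, ((EReal.bot_lt_coe _).trans_le l0).ne'⟩ with b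
      rw [round_eq_coe (by norm_num)]
      rw [EReal.coe_le_coe_iff] at u1 u0 ⊢
      have e : Real.log (1 / 2) = -Real.log 2 := by simp
      rw [show (1 - 1 / 2 : ℝ) = 1 / 2 by norm_num, e]
      push_cast
      have := mul_le_mul_of_nonneg_left u1 hp.1
      have := mul_le_mul_of_nonneg_left u0 (by linarith [hp.2] : 0 ≤ 1 - p)
      nlinarith

lemma coe_toReal_gval {δ : ℝ} (hδ : δ ∈ Set.Ioo (0 : ℝ) (1 / 2)) {S : Set (X → ℝ)}
    (hS : S.Nonempty)
    (hSval : ∀ f ∈ S, ∀ z, f z ∈ Set.Icc δ (1 - δ)) {XC : List (X × Bool) → Set X}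
    (hXC : ∀ h, (XC h).Nonempty) (m : ℕ) (h : List (X × Bool)) :
    (((gval S XC m h).toReal : ℝ) : EReal) = gval S XC m h := by
  obtain ⟨l, u⟩ := gval_bounds hδ hS hSval hXC m h
  exact EReal.coe_toReal (u.trans_lt (EReal.coe_lt_top _)).ne
    ((EReal.bot_lt_coe _).trans_le l).ne.symm

/-- The forecast that equalizes the two outcomes of a round. -/
lemma exists_equalizer (a b : ℝ) : ∃ q ∈ Set.Ioo (0 : ℝ) 1,
    -Real.log q + a = -Real.log (1 - q) + b := by
  have ha := Real.exp_pos a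
  have hb := Real.exp_pos b
  have e : 1 - Real.exp a / (Real.exp a + Real.exp b) =
      Real.exp b / (Real.exp a + Real.exp b) := by field_simp; ring
  refine ⟨Real.exp a / (Real.exp a + Real.exp b), ⟨by positivity, ?_⟩, ?_⟩
  · rw [div_lt_one (by positivity)]
    linarith
  · rw [e, Real.log_div ha.ne' (by positivity), Real.log_div hb.ne' (by positivity),
      Real.log_exp, Real.log_exp]
    ring

/-- Up to `ε`, one round of the game is a choice of side information and of a bias for which
the forecaster's best response is that bias. -/
lemma exists_near_optimal_round {δ : ℝ} (hδ : δ ∈ Set.Ioo (0 : ℝ) (1 / 2)) {S : Set (X → ℝ)}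
    (hS : S.Nonempty)
    (hSval : ∀ f ∈ S, ∀ z, f z ∈ Set.Icc δ (1 - δ)) {XC : List (X × Bool) → Set X}
    (hXC : ∀ h, (XC h).Nonempty) {ε : ℝ} (hε : 0 < ε) (m : ℕ) (h : List (X × Bool)) :
    ∃ x ∈ XC h, ∃ q ∈ Set.Ioo (0 : ℝ) 1,
      (gval S XC (m + 1) h).toReal ≤
        ε + (q * (-Real.log q + (gval S XC m (h ++ [(x, true)])).toReal) +
          (1 - q) * (-Real.log (1 - q) + (gval S XC m (h ++ [(x, false)])).toReal)) := by
  have hlt : (((gval S XC (m + 1) h).toReal - ε : ℝ) : EReal) < gval S XC (m + 1) h := by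
    conv_rhs => rw [← coe_toReal_gval hδ hS hSval hXC (m + 1) h]
    exact EReal.coe_lt_coe_iff.2 (by linarith)
  conv_rhs at hlt => rw [gval]
  obtain ⟨x, hlt⟩ := lt_iSup_iff.1 hlt
  obtain ⟨hx, hlt⟩ := lt_iSup_iff.1 hlt
  obtain ⟨q, hq, heq⟩ := exists_equalizer (gval S XC m (h ++ [(x, true)])).toReal
    (gval S XC m (h ++ [(x, false)])).toReal
  refine ⟨x, hx, q, hq, ?_⟩
  have h1 := hlt.le.trans (iInf₂_le q ⟨hq.1.le, hq.2.le⟩)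
  rw [← sub_le_iff_le_add', ← EReal.coe_le_coe_iff]
  refine h1.trans (iSup₂_le fun p _ => ?_)
  rw [← coe_toReal_gval hδ hS hSval hXC m (h ++ [(x, true)]),
    ← coe_toReal_gval hδ hS hSval hXC m (h ++ [(x, false)]), round_eq_coe hq,
    EReal.coe_le_coe_iff]
  simp only [EReal.toReal_coe, heq]
  exact le_of_eq (by ring)

/-- The history reached from `h` when side information is chosen by the strategy `s` and the
outcomes are `bs`. -/
def play (s : List (X × Bool) → X) (h : List (X × Bool)) (bs : List Bool) : List (X × Bool) :=
  bs.foldl (fun h b => h ++ [(s h, b)]) h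

lemma play_cons (s : List (X × Bool) → X) (h : List (X × Bool)) (b : Bool) (bs : List Bool) :
    play s h (b :: bs) = play s (h ++ [(s h, b)]) bs := rfl

/-- The tree obtained by evaluating a function of histories along `play`. -/
def stratTree {Z : Type*} (s : List (X × Bool) → X) (u : List (X × Bool) → Z)
    (h : List (X × Bool)) (n : ℕ) (y : Fin n → Bool) (t : Fin n) : Z :=
  u (play s h ((List.ofFn y).take t))

lemma stratTree_cons_zero {Z : Type*} (s : List (X × Bool) → X) (u : List (X × Bool) → Z)
    (h : List (X × Bool)) (n : ℕ) (b : Bool) (y : Fin n → Bool) :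
    stratTree s u h (n + 1) (Fin.cons b y) 0 = u h := by
  simp [stratTree, play]

lemma stratTree_cons_succ {Z : Type*} (s : List (X × Bool) → X) (u : List (X × Bool) → Z)
    (h : List (X × Bool)) (n : ℕ) (b : Bool) (y : Fin n → Bool) (t : Fin n) :
    stratTree s u h (n + 1) (Fin.cons b y) t.succ =
      stratTree s u (h ++ [(s h, b)]) n y t := by
  simp [stratTree, play, List.ofFn_succ]

lemma play_ofFn (s : List (X × Bool) → X) (h : List (X × Bool)) (n : ℕ) (y : Fin n → Bool) :
    play s h (List.ofFn y) = h ++ List.ofFn fun t => (stratTree s s h n y t, y t) := by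
  induction n generalizing h with
  | zero => simp [play]
  | succ n ih =>
    induction y using Fin.consCases with
    | cons b y =>
      simp only [List.ofFn_succ, Fin.cons_zero, Fin.cons_succ, play_cons, ih,
        stratTree_cons_zero, stratTree_cons_succ]
      simp

lemma take_ofFn_eq {n : ℕ} (y : Fin n → Bool) (t : Fin n) :
    (List.ofFn y).take t = List.ofFn fun s : Fin t.val => y ⟨s.val, s.isLt.trans t.isLt⟩ := by
  apply List.ext_getElem
  · simp
  · intro i h1 h2
    simp

lemma predictable_stratTree {Z : Type*} (s : List (X × Bool) → X) (u : List (X × Bool) → Z)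
    (h : List (X × Bool)) (n : ℕ) : Predictable n (stratTree s u h n) := by
  intro y y' t hy
  simp only [stratTree, take_ofFn_eq]
  congr 3
  funext i
  exact hy _ i.isLt

lemma consistentTree_stratTree {XC : List (X × Bool) → Set X} {s : List (X × Bool) → X}
    (hs : ∀ h, s h ∈ XC h) (n : ℕ) : ConsistentTree n XC (stratTree s s [] n) := by
  refine ⟨predictable_stratTree s s [] n, fun y t => ?_⟩
  have : histOf n (stratTree s s [] n) y t = play s [] ((List.ofFn y).take t) := by
    rw [take_ofFn_eq, play_ofFn, List.nil_append, histOf]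
    congr 1
    funext i
    simp only [stratTree, Prod.mk.injEq, and_true]
    congr 2
    apply List.ext_getElem
    · simp
      omega
    · intro j h1 h2
      simp
  rw [this]
  exact hs _

/-- The expectation over paths, decomposed according to the first outcome. -/
lemma sum_bweight_stratTree_succ (s : List (X × Bool) → X) (q : List (X × Bool) → ℝ)
    (h : List (X × Bool)) (n : ℕ) (φ : (Fin (n + 1) → Bool) → ℝ) :
    ∑ y, bweight (n + 1) (stratTree s q h (n + 1)) y * φ y =
      q h * ∑ y, bweight n (stratTree s q (h ++ [(s h, true)]) n) y * φ (Fin.cons true y) +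
      (1 - q h) *
        ∑ y, bweight n (stratTree s q (h ++ [(s h, false)]) n) y * φ (Fin.cons false y) := by
  rw [← (Fin.consEquiv fun _ => Bool).sum_comp, Fintype.sum_prod_type, Fintype.sum_bool,
    Finset.mul_sum, Finset.mul_sum]
  congr 1 <;> refine Finset.sum_congr rfl fun y _ => ?_ <;>
    simp [bweight, Fin.prod_univ_succ, Fin.consEquiv, stratTree_cons_zero, stratTree_cons_succ,
      mul_assoc]

/-- Backward induction: a potential `G` over histories that grows by at most `c` per round
beyond the increments `r` is bounded by the expectation along the tree. -/
lemma potential_le_sum_bweight (s : List (X × Bool) → X) (q : List (X × Bool) → ℝ)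
    (hq : ∀ h, q h ∈ Set.Icc (0 : ℝ) 1) (r : ℝ → Bool → ℝ) (c : ℝ) (N : ℕ)
    (G : ℕ → List (X × Bool) → ℝ)
    (hG : ∀ m h, h.length + (m + 1) = N → G (m + 1) h ≤
      c + (q h * (r (q h) true + G m (h ++ [(s h, true)])) +
        (1 - q h) * (r (q h) false + G m (h ++ [(s h, false)]))))
    (m : ℕ) (h : List (X × Bool)) (hm : h.length + m = N) (a : ℝ) :
    a + G m h ≤ m * c + ∑ y, bweight m (stratTree s q h m) y *
      (a + ∑ t, r (stratTree s q h m y t) (y t) + G 0 (play s h (List.ofFn y))) := by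
  induction m generalizing h a with
  | zero => simp [bweight, play]
  | succ m ih =>
    rw [sum_bweight_stratTree_succ]
    have h1 := ih (h ++ [(s h, true)]) (by simp; omega) (a + r (q h) true)
    have h0 := ih (h ++ [(s h, false)]) (by simp; omega) (a + r (q h) false)
    have hstep := hG m h hm
    have h1' := mul_le_mul_of_nonneg_left h1 (hq h).1
    have h0' := mul_le_mul_of_nonneg_left h0 (by linarith [(hq h).2] : 0 ≤ 1 - q h)
    simp only [Fin.sum_univ_succ, stratTree_cons_zero, stratTree_cons_succ, Fin.cons_zero,
      Fin.cons_succ, List.ofFn_succ, play_cons]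
    simp only [← add_assoc] at h1' h0' ⊢
    push_cast
    linarith

/-- The loss incurred when the bias lies outside of `[δ, 1 - δ]` and the rare outcome occurs. -/
def truncErr (δ p : ℝ) (b : Bool) : ℝ :=
  if p < δ ∧ b = true ∨ 1 - δ < p ∧ b = false then realLoss p b else 0

lemma mul_neg_log_le {δ p : ℝ} (hδ : δ ∈ Set.Ioo (0 : ℝ) (1 / 2)) (hp : 0 < p) (hpδ : p < δ) :
    p * -Real.log p ≤ 2 * δ * Real.log (1 / δ) := by
  have hL : 1 / 2 < Real.log (1 / δ) := by
    have h2 : Real.log 2 ≤ Real.log (1 / δ) := by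
      apply Real.log_le_log (by norm_num)
      rw [le_div_iff₀ hδ.1]
      linarith [hδ.2]
    linarith [Real.log_two_gt_d9]
  have h1 := Real.log_le_sub_one_of_pos (div_pos hδ.1 hp)
  rw [Real.log_div hδ.1.ne' hp.ne'] at h1
  have h2 := mul_le_mul_of_nonneg_left h1 hp.le
  have h3 : p * (δ / p - 1) = δ - p := by field_simp
  rw [one_div δ, Real.log_inv] at hL ⊢
  rw [h3] at h2
  rcases le_total 1 (-Real.log δ) with h | h
  · nlinarith [hδ.1]
  · nlinarith [hδ.1]

lemma expect_truncErr_le {δ p : ℝ} (hδ : δ ∈ Set.Ioo (0 : ℝ) (1 / 2))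
    (hp : p ∈ Set.Ioo (0 : ℝ) 1) :
    p * truncErr δ p true + (1 - p) * truncErr δ p false ≤ 2 * δ * Real.log (1 / δ) := by
  have hc : 0 ≤ 2 * δ * Real.log (1 / δ) := by
    have := Real.log_nonneg (x := 1 / δ) (by rw [le_div_iff₀ hδ.1]; linarith [hδ.2])
    have := hδ.1
    positivity
  obtain ⟨d0, d1⟩ := hδ
  by_cases h1 : p < δ
  · have h2 : ¬ 1 - δ < p := by linarith
    simpa [truncErr, h1, h2, realLoss] using mul_neg_log_le ⟨d0, d1⟩ hp.1 h1
  · by_cases h2 : 1 - δ < p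
    · simpa [truncErr, h1, h2, realLoss] using
        mul_neg_log_le ⟨d0, d1⟩ (by linarith [hp.2] : 0 < 1 - p) (by linarith)
    · simpa [truncErr, h1, h2] using hc

lemma neg_log_strong_convex {a b : ℝ} (ha : 0 < a) (ha1 : a ≤ 1) (hb : 0 < b) (hb1 : b ≤ 1) :
    -Real.log a + Real.log b ≤ -1 / a * (a - b) - 1 / 2 * (a - b) ^ 2 := by
  let D : ℝ → ℝ := fun x => -Real.log x + x / a - 1 / 2 * (x - a) ^ 2
  have hD : ∀ x, 0 < x → HasDerivAt D ((x - a) * (1 / (a * x) - 1)) x := by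
    intro x hx
    have h := (((Real.hasDerivAt_log hx.ne').neg.add ((hasDerivAt_id x).div_const a))).sub
      ((((hasDerivAt_id x).sub_const a).pow 2).const_mul (1 / 2 : ℝ))
    refine h.congr_deriv ?_
    simp only [id]
    field_simp
    ring
  have hfac : ∀ x, 0 < x → x ≤ 1 → 0 ≤ 1 / (a * x) - 1 := by
    intro x hx hx1
    rw [sub_nonneg, le_div_iff₀ (by positivity)]
    nlinarith
  have key : D a ≤ D b := by
    rcases le_total a b with hab | hab
    · refine monotoneOn_of_hasDerivWithinAt_nonneg (convex_Icc a b)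
        (fun x hx => (hD x (ha.trans_le hx.1)).continuousAt.continuousWithinAt)
        (fun x hx => (hD x ?_).hasDerivWithinAt) (fun x hx => ?_) (Set.left_mem_Icc.2 hab)
        (Set.right_mem_Icc.2 hab) hab
      · exact ha.trans_le (interior_subset hx).1
      · have := interior_subset hx
        exact mul_nonneg (by linarith [this.1]) (hfac x (ha.trans_le this.1) (this.2.trans hb1))
    · refine antitoneOn_of_hasDerivWithinAt_nonpos (convex_Icc b a)
        (fun x hx => (hD x (hb.trans_le hx.1)).continuousAt.continuousWithinAt)
        (fun x hx => (hD x ?_).hasDerivWithinAt) (fun x hx => ?_) (Set.left_mem_Icc.2 hab)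
        (Set.right_mem_Icc.2 hab) hab
      · exact hb.trans_le (interior_subset hx).1
      · have := interior_subset hx
        exact mul_nonpos_of_nonpos_of_nonneg (by linarith [this.2])
          (hfac x (hb.trans_le this.1) (this.2.trans ha1))
  have e : -1 / a * (a - b) = b / a - a / a := by field_simp; ring
  simp only [D] at key
  rw [e]
  linarith [sq_nonneg (a - b), show (b - a) ^ 2 = (a - b) ^ 2 by ring,
    show (a - a) ^ 2 = (0 : ℝ) by ring]

lemma realLoss_sub_le {δ p v : ℝ} (hδ : δ ∈ Set.Ioo (0 : ℝ) (1 / 2))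
    (hp : p ∈ Set.Ioo (0 : ℝ) 1) (hv : v ∈ Set.Icc δ (1 - δ)) (b : Bool) :
    realLoss p b - truncErr δ p b - realLoss v b ≤
      if p ∈ Set.Icc δ (1 - δ) then eta p b * (p - v) - (1 / 2) * (p - v) ^ 2 else 0 := by
  obtain ⟨d0, d1⟩ := hδ
  obtain ⟨v0, v1⟩ := hv
  obtain ⟨p0, p1⟩ := hp
  split_ifs with hI
  · have e : truncErr δ p b = 0 := by simp [truncErr, hI.1.not_gt, hI.2.not_gt]
    rw [e]
    cases b
    · have := neg_log_strong_convex (a := 1 - p) (b := 1 - v) (by linarith) (by linarith)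
        (by linarith) (by linarith)
      simp only [realLoss, eta, Bool.false_eq_true, if_false]
      calc _ = -Real.log (1 - p) + Real.log (1 - v) := by ring
        _ ≤ _ := this
        _ = _ := by ring
    · have := neg_log_strong_convex (a := p) (b := v) p0 p1.le (by linarith) (by linarith)
      simp only [realLoss, eta, if_true]
      linarith
  · have hv01 : v ∈ Set.Icc (0 : ℝ) 1 := ⟨by linarith, by linarith⟩
    by_cases h : p < δ ∧ b = true ∨ 1 - δ < p ∧ b = false
    · have := realLoss_nonneg hv01 b
      simp only [truncErr, if_pos h]
      linarith
    · simp only [truncErr, if_neg h]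
      rw [Set.mem_Icc, not_and_or, not_le, not_le] at hI
      cases b
      · have h1 : p < δ := hI.resolve_right fun h' => h (Or.inr ⟨h', rfl⟩)
        have := Real.log_le_log (by linarith : 0 < 1 - v) (by linarith : 1 - v ≤ 1 - p)
        simp only [realLoss, Bool.false_eq_true, if_false]
        linarith
      · have h1 : 1 - δ < p := hI.resolve_left fun h' => h (Or.inl ⟨h', rfl⟩)
        have := Real.log_le_log (by linarith : 0 < v) (by linarith : v ≤ p)
        simp only [realLoss, if_true]
        linarith

lemma le_ciSup_mem {ι : Type*} {S : Set ι} {φ : ι → ℝ} {B : ℝ} (hB : ∀ i ∈ S, φ i ≤ B) {i : ι}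
    (hi : i ∈ S) : φ i ≤ ⨆ j ∈ S, φ j := by
  have hbdd : BddAbove (Set.range fun j => ⨆ _ : j ∈ S, φ j) := by
    refine ⟨max B 0, ?_⟩
    rintro _ ⟨j, rfl⟩
    by_cases hj : j ∈ S
    · simpa [hj] using Or.inl (hB j hj)
    · simp [hj]
  refine le_trans ?_ (le_ciSup hbdd i)
  simp [hi]

lemma trunc_mem {δ : ℝ} (hδ : δ ∈ Set.Ioo (0 : ℝ) (1 / 2)) (a : ℝ) :
    trunc δ a ∈ Set.Icc δ (1 - δ) := by
  obtain ⟨d0, d1⟩ := hδ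
  unfold trunc
  split_ifs <;> constructor <;> linarith

lemma bweight_nonneg {n : ℕ} {p : (Fin n → Bool) → Fin n → ℝ}
    (hp : ∀ y t, p y t ∈ Set.Icc (0 : ℝ) 1) (y : Fin n → Bool) : 0 ≤ bweight n p y := by
  refine Finset.prod_nonneg fun t _ => ?_
  split_ifs
  · exact (hp y t).1
  · linarith [(hp y t).2]

/-- Theorem 1 of the paper: the minimax regret of the truncated class `F^δ`
is at most the offset complexity with biased coin flips, plus `2nδ log(1/δ)`. -/
theorem stmt0 [Nonempty X] (n : ℕ) (hn : 1 ≤ n)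
    (XC : List (X × Bool) → Set X) (hXC : ∀ h, (XC h).Nonempty)
    (F : Set (X → ℝ)) (hF : F.Nonempty)
    (hFval : ∀ f ∈ F, ∀ z : X, f z ∈ Set.Icc (0 : ℝ) 1)
    (δ : ℝ) (hδ : δ ∈ Set.Ioo (0 : ℝ) (1 / 2)) :
    minimaxV ((fun f : X → ℝ => fun z => trunc δ (f z)) '' F) XC n ≤
      (⨆ x : {x : (Fin n → Bool) → Fin n → X // ConsistentTree n XC x},
        ⨆ μ : {μ : (Fin n → Bool) → Fin n → ℝ //
                Predictable n μ ∧ ∀ y t, μ y t ∈ Set.Icc (0 : ℝ) 1},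
        ⨆ p : {p : (Fin n → Bool) → Fin n → ℝ //
                Predictable n p ∧ ∀ y t, p y t ∈ Set.Icc (0 : ℝ) 1},
        (((∑ y : Fin n → Bool, bweight n p.1 y *
            (⨆ f ∈ (fun f : X → ℝ => fun z => trunc δ (f z)) '' F,
              ∑ t : Fin n,
                if p.1 y t ∈ Set.Icc δ (1 - δ) then
                  eta (p.1 y t) (y t) * (μ.1 y t - f (x.1 y t)) -
                    (1 / 2) * (μ.1 y t - f (x.1 y t)) ^ 2
                else 0)) : ℝ) : EReal)) +
      ((2 * n * δ * Real.log (1 / δ) : ℝ) : EReal) := by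
  set S := (fun f : X → ℝ => fun z => trunc δ (f z)) '' F
  have hS : S.Nonempty := hF.image _
  have hSval : ∀ f ∈ S, ∀ z, f z ∈ Set.Icc δ (1 - δ) := by
    rintro _ ⟨f, -, rfl⟩ z
    exact trunc_mem hδ (f z)
  have hsub : ∀ f ∈ S, ∀ z, f z ∈ Set.Ioo (0 : ℝ) 1 := fun f hf z =>
    ⟨hδ.1.trans_le (hSval f hf z).1, by linarith [(hSval f hf z).2, hδ.1]⟩
  rw [minimaxV, ← coe_toReal_gval hδ hS hSval hXC n []]
  refine le_of_forall_lt fun w hw => ?_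
  obtain ⟨w', hww', hw'⟩ := EReal.lt_iff_exists_real_btwn.1 hw
  refine hww'.trans_le ?_
  rw [EReal.coe_lt_coe_iff] at hw'
  have hn0 : (0 : ℝ) < n := by exact_mod_cast hn
  set g := (gval S XC n []).toReal
  have hε : 0 < (g - w') / n := div_pos (by linarith) hn0
  choose s hs q hq hstep using fun m h => exists_near_optimal_round hδ hS hSval hXC hε m h
  let s' : List (X × Bool) → X := fun h => s (n - 1 - h.length) h
  let q' : List (X × Bool) → ℝ := fun h => q (n - 1 - h.length) h
  have hq' : ∀ h, q' h ∈ Set.Ioo (0 : ℝ) 1 := fun h => hq _ h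
  have hqI : ∀ h, q' h ∈ Set.Icc (0 : ℝ) 1 := fun h => ⟨(hq' h).1.le, (hq' h).2.le⟩
  have main := potential_le_sum_bweight s' q' hqI (fun p b => realLoss p b - truncErr δ p b)
    ((g - w') / n + 2 * δ * Real.log (1 / δ)) n (fun m h => (gval S XC m h).toReal) (by
      intro m h hm
      have e : n - 1 - h.length = m := by omega
      have h1 := hstep m h
      have h2 := expect_truncErr_le hδ (hq m h)
      simp only [s', q', e]
      simp only [realLoss, if_true, Bool.false_eq_true, if_false]
      linarith) n [] (by simp) 0
  let xT := stratTree s' s' [] n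
  let pT := stratTree s' q' [] n
  have hpT : ∀ y t, pT y t ∈ Set.Icc (0 : ℝ) 1 := fun y t => hqI _
  have hpath : ∀ y, (0 + ∑ t, (realLoss (pT y t) (y t) - truncErr δ (pT y t) (y t)) +
      (gval S XC 0 (play s' [] (List.ofFn y))).toReal) ≤
      ⨆ f ∈ S, ∑ t : Fin n,
        if pT y t ∈ Set.Icc δ (1 - δ) then
          eta (pT y t) (y t) * (pT y t - f (xT y t)) -
            (1 / 2) * (pT y t - f (xT y t)) ^ 2
        else 0 := by
    intro y
    rw [← le_sub_iff_add_le', ← EReal.coe_le_coe_iff, coe_toReal_gval hδ hS hSval hXC, gval,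
      EReal.neg_le, ← EReal.coe_neg]
    refine le_iInf₂ fun f hf => ?_
    rw [cumLoss_eq_coe (hsub f hf), EReal.coe_le_coe_iff, play_ofFn, List.nil_append,
      List.map_ofFn, List.sum_ofFn]
    have hle : ∑ t : Fin n, (realLoss (pT y t) (y t) - truncErr δ (pT y t) (y t) -
        realLoss (f (xT y t)) (y t)) ≤ ∑ t : Fin n,
        if pT y t ∈ Set.Icc δ (1 - δ) then
          eta (pT y t) (y t) * (pT y t - f (xT y t)) -
            (1 / 2) * (pT y t - f (xT y t)) ^ 2
        else 0 :=
      Finset.sum_le_sum fun t _ => realLoss_sub_le hδ (hq' _) (hSval f hf _) (y t)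
    rw [Finset.sum_sub_distrib] at hle
    have hsup := le_ciSup_mem (S := S) (φ := fun f => ∑ t : Fin n,
        if pT y t ∈ Set.Icc δ (1 - δ) then
          eta (pT y t) (y t) * (pT y t - f (xT y t)) -
            (1 / 2) * (pT y t - f (xT y t)) ^ 2
        else 0) (B := ∑ t, |eta (pT y t) (y t)|) (by
      intro f hf
      refine Finset.sum_le_sum fun t _ => ?_
      split_ifs
      · have h1 : |pT y t - f (xT y t)| ≤ 1 := by
          have := hsub f hf (xT y t)
          have := hpT y t
          rw [abs_le]
          constructor <;> linarith [this.1, this.2, (hsub f hf (xT y t)).1,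
            (hsub f hf (xT y t)).2]
        have h2 := le_abs_self (eta (pT y t) (y t) * (pT y t - f (xT y t)))
        rw [abs_mul] at h2
        have h3 := mul_le_mul_of_nonneg_left h1 (abs_nonneg (eta (pT y t) (y t)))
        nlinarith [sq_nonneg (pT y t - f (xT y t))]
      · exact abs_nonneg _) hf
    have hcomp : ∑ t, ((fun z : X × Bool => realLoss (f z.1) z.2) ∘
        fun t => (stratTree s' s' [] n y t, y t)) t = ∑ t, realLoss (f (xT y t)) (y t) := rfl
    rw [hcomp]
    linarith
  have hfin : w' ≤ (∑ y : Fin n → Bool, bweight n pT y *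
      (⨆ f ∈ S, ∑ t : Fin n,
        if pT y t ∈ Set.Icc δ (1 - δ) then
          eta (pT y t) (y t) * (pT y t - f (xT y t)) -
            (1 / 2) * (pT y t - f (xT y t)) ^ 2
        else 0)) + 2 * n * δ * Real.log (1 / δ) := by
    have h1 := Finset.sum_le_sum fun y (_ : y ∈ Finset.univ) =>
      mul_le_mul_of_nonneg_left (hpath y) (bweight_nonneg hpT y)
    have h2 := main.trans (add_le_add_right h1 _)
    have h3 : (n : ℝ) * ((g - w') / n + 2 * δ * Real.log (1 / δ)) =
        (g - w') + 2 * n * δ * Real.log (1 / δ) := by field_simp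
    rw [h3] at h2
    linarith
  refine (EReal.coe_le_coe_iff.2 hfin).trans ?_
  rw [EReal.coe_add]
  gcongr
  refine le_trans ?_ (le_iSup _ (⟨xT, consistentTree_stratTree (fun h => hs _ h) n⟩ :
    {x : (Fin n → Bool) → Fin n → X // ConsistentTree n XC x}))
  have hpP : Predictable n pT ∧ ∀ y t, pT y t ∈ Set.Icc (0 : ℝ) 1 :=
    ⟨predictable_stratTree s' q' [] n, hpT⟩
  refine le_trans ?_ (le_iSup _ (⟨pT, hpP⟩ : {μ : (Fin n → Bool) → Fin n → ℝ //
    Predictable n μ ∧ ∀ y t, μ y t ∈ Set.Icc (0 : ℝ) 1}))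
  exact le_iSup_of_le (⟨pT, hpP⟩ : {p : (Fin n → Bool) → Fin n → ℝ //
    Predictable n p ∧ ∀ y t, p y t ∈ Set.Icc (0 : ℝ) 1}) le_rfl

end
end

section
/- Let X be a set equipped with a preorder ⪯, let k ≥ 1, and let F be a class of functions X → {0,1,…,k} such that every ordered X-valued tree 2-shattered by F has depth at most d. Then for any n > d and any ordered X-valued tree x of depth n, there is a sequential 1/2-cover (in ℓ∞) of F on x of cardinality at most Σ_{i=0}^d C(n,i)·k^i; that is, N_∞(F, 1/2, x) ≤ Σ_{i=0}^d C(n,i)·k^i. -/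
/-- An `X`-valued tree is ordered if its labels are nondecreasing (w.r.t. the preorder on
`X`) along every path. -/
def OrderedTree {X : Type*} [Preorder X] (n : ℕ) (x : (Fin n → Bool) → Fin n → X) : Prop :=
  ∀ (y : Fin n → Bool) (t : Fin n) (h : t.val + 1 < n), x y t ≤ x y ⟨t.val + 1, h⟩

/-- The tree `x` of depth `D` is `β`-shattered by `F` with witness tree `s`. -/
def ShatteredBy {X : Type*} (F : Set (X → ℝ)) (β : ℝ) (D : ℕ)
    (x : (Fin D → Bool) → Fin D → X) (s : (Fin D → Bool) → Fin D → ℝ) : Prop :=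
  Predictable D x ∧ Predictable D s ∧
    ∀ y : Fin D → Bool, ∃ f ∈ F, ∀ t : Fin D,
      (if y t then (1 : ℝ) else -1) * (f (x y t) - s y t) ≥ β / 2

/-- `V` is a sequential `γ`-cover (in `ℓ∞`) of `F` on the tree `x`. -/
def IsCoverOn {X : Type*} (n : ℕ) (F : Set (X → ℝ)) (x : (Fin n → Bool) → Fin n → X)
    (γ : ℝ) (V : Finset ((Fin n → Bool) → Fin n → ℝ)) : Prop :=
  (∀ v ∈ V, Predictable n v) ∧
    ∀ f ∈ F, ∀ y : Fin n → Bool, ∃ v ∈ V, ∀ t : Fin n, |v y t - f (x y t)| ≤ γ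

/-- The tree with root label `r` and subtrees `z false`, `z true`. -/
def glueTree {Z : Type*} {n : ℕ} (r : Z) (z : Bool → (Fin n → Bool) → Fin n → Z) :
    (Fin (n + 1) → Bool) → Fin (n + 1) → Z :=
  fun y => Fin.cons r (z (y 0) (Fin.tail y))

/-- The subtree of `x` hanging below the root in direction `b`. -/
def subTree {Z : Type*} {n : ℕ} (x : (Fin (n + 1) → Bool) → Fin (n + 1) → Z) (b : Bool) :
    (Fin n → Bool) → Fin n → Z :=
  fun y t => x (Fin.cons b y) t.succ

section Trees

variable {Z : Type*} {n : ℕ}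

@[simp] lemma glueTree_zero (r : Z) (z : Bool → (Fin n → Bool) → Fin n → Z)
    (y : Fin (n + 1) → Bool) : glueTree r z y 0 = r := rfl

@[simp] lemma glueTree_succ (r : Z) (z : Bool → (Fin n → Bool) → Fin n → Z)
    (y : Fin (n + 1) → Bool) (t : Fin n) :
    glueTree r z y t.succ = z (y 0) (Fin.tail y) t := rfl

lemma subTree_apply_tail (x : (Fin (n + 1) → Bool) → Fin (n + 1) → Z)
    (y : Fin (n + 1) → Bool) (t : Fin n) : subTree x (y 0) (Fin.tail y) t = x y t.succ := by
  simp [subTree, Fin.cons_self_tail]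

lemma Predictable.glueTree {r : Z} {z : Bool → (Fin n → Bool) → Fin n → Z}
    (hz : ∀ b, Predictable n (z b)) : Predictable (n + 1) (glueTree r z) := by
  intro y y' t h
  cases t using Fin.cases with
  | zero => rfl
  | succ t =>
    rw [glueTree_succ, glueTree_succ, h 0 (Fin.succ_pos t)]
    exact hz _ _ _ t fun s hs => h s.succ (Fin.succ_lt_succ_iff.2 hs)

lemma Predictable.subTree {x : (Fin (n + 1) → Bool) → Fin (n + 1) → Z}
    (hx : Predictable (n + 1) x) (b : Bool) : Predictable n (subTree x b) := by
  intro y y' t h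
  refine hx _ _ _ fun s hs => ?_
  cases s using Fin.cases with
  | zero => rfl
  | succ s => simpa using h s (Fin.succ_lt_succ_iff.1 hs)

lemma Predictable.root_eq {x : (Fin (n + 1) → Bool) → Fin (n + 1) → Z}
    (hx : Predictable (n + 1) x) (y y' : Fin (n + 1) → Bool) : x y 0 = x y' 0 :=
  hx _ _ _ fun s hs => absurd hs (Fin.not_lt_zero s)

end Trees

lemma ShatteredBy.mono {X : Type*} {F G : Set (X → ℝ)} (h : F ⊆ G) {β : ℝ} {D : ℕ}
    {x : (Fin D → Bool) → Fin D → X} {s : (Fin D → Bool) → Fin D → ℝ}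
    (hs : ShatteredBy F β D x s) : ShatteredBy G β D x s :=
  ⟨hs.1, hs.2.1, fun y => (hs.2.2 y).imp fun _ hf => ⟨h hf.1, hf.2⟩⟩

section Ordered

variable {X : Type*} [Preorder X] {n : ℕ}

lemma OrderedTree.glueTree {r : X} {z : Bool → (Fin n → Bool) → Fin n → X}
    (hz : ∀ b, OrderedTree n (z b)) (hr : ∀ b y t, r ≤ z b y t) :
    OrderedTree (n + 1) (glueTree r z) := by
  intro y t h
  cases t using Fin.cases with
  | zero => exact hr (y 0) (Fin.tail y) ⟨0, by simpa using h⟩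
  | succ t => exact hz (y 0) (Fin.tail y) t (by simpa using h)

lemma OrderedTree.subTree {x : (Fin (n + 1) → Bool) → Fin (n + 1) → X}
    (hx : OrderedTree (n + 1) x) (b : Bool) : OrderedTree n (subTree x b) :=
  fun y t h => hx (Fin.cons b y) t.succ (by simpa using h)

lemma OrderedTree.root_le {x : (Fin (n + 1) → Bool) → Fin (n + 1) → X}
    (hx : OrderedTree (n + 1) x) (y : Fin (n + 1) → Bool) (t : Fin (n + 1)) :
    x y 0 ≤ x y t := by
  induction t using Fin.induction with
  | zero => exact le_rfl
  | succ t ih => exact ih.trans (hx y t.castSucc (by simp))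

/-- Every ordered tree with labels in `U` that is `2`-shattered by `F` has depth less
than `e`. -/
def OrderedDimLT (F : Set (X → ℝ)) (U : Set X) (e : ℕ) : Prop :=
  ∀ (D : ℕ) (x : (Fin D → Bool) → Fin D → X) (s : (Fin D → Bool) → Fin D → ℝ),
    OrderedTree D x → (∀ y t, x y t ∈ U) → ShatteredBy F 2 D x s → D < e

lemma OrderedDimLT.mono {F G : Set (X → ℝ)} {U W : Set X} {e : ℕ}
    (h : OrderedDimLT G W e) (hFG : F ⊆ G) (hUW : U ⊆ W) : OrderedDimLT F U e :=
  fun D x s hx hU hs => h D x s hx (fun y t => hUW (hU y t)) (hs.mono hFG)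

lemma OrderedDimLT.eq_empty {F : Set (X → ℝ)} {U : Set X} (h : OrderedDimLT F U 0) :
    F = ∅ := by
  by_contra hne
  obtain ⟨f, hf⟩ := Set.nonempty_iff_ne_empty.2 hne
  exact absurd (h 0 (fun _ t => t.elim0) (fun _ t => t.elim0) (fun _ t => t.elim0)
    (fun _ t => t.elim0) ⟨fun _ _ t => t.elim0, fun _ _ t => t.elim0,
      fun _ => ⟨f, hf, fun t => t.elim0⟩⟩) (lt_irrefl 0)

/-- If two value classes at `a` whose values differ by at least `2` both shatter trees of
depth `e` above `a`, gluing these trees below `a` gives a shattered tree of depth `e + 1`. -/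
lemma OrderedDimLT.value_class {F : Set (X → ℝ)} {a : X} {e i j : ℕ}
    (h : OrderedDimLT F (Set.Ici a) (e + 1)) (hij : i + 2 ≤ j) :
    OrderedDimLT {f ∈ F | f a = i} (Set.Ici a) e ∨
      OrderedDimLT {f ∈ F | f a = j} (Set.Ici a) e := by
  have key : ∀ m : ℕ, ¬ OrderedDimLT {f ∈ F | f a = m} (Set.Ici a) e →
      ∃ (x : (Fin e → Bool) → Fin e → X) (s : (Fin e → Bool) → Fin e → ℝ),
        OrderedTree e x ∧ (∀ y t, x y t ∈ Set.Ici a) ∧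
          ShatteredBy {f ∈ F | f a = m} 2 e x s := by
    intro m hm
    unfold OrderedDimLT at hm
    push Not at hm
    obtain ⟨D, x, s, hx, hU, hs, hD⟩ := hm
    have := h D x s hx hU (hs.mono (Set.sep_subset _ _))
    obtain rfl : D = e := by omega
    exact ⟨x, s, hx, hU, hs⟩
  by_contra! hcon
  obtain ⟨x₀, s₀, hx₀, hU₀, hp₀, hq₀, hs₀⟩ := key i hcon.1
  obtain ⟨x₁, s₁, hx₁, hU₁, hp₁, hq₁, hs₁⟩ := key j hcon.2
  have hij' : (i : ℝ) + 2 ≤ j := by exact_mod_cast hij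
  let x : Bool → (Fin e → Bool) → Fin e → X := fun b => bif b then x₁ else x₀
  let s : Bool → (Fin e → Bool) → Fin e → ℝ := fun b => bif b then s₁ else s₀
  have hU : ∀ b y t, a ≤ x b y t := by rintro (_ | _) <;> assumption
  refine absurd (h (e + 1) (glueTree a x) (glueTree (i + 1 : ℝ) s)
    (.glueTree (by rintro (_ | _) <;> assumption) hU) (fun y t => ?_)
    ⟨.glueTree (by rintro (_ | _) <;> assumption),
      .glueTree (by rintro (_ | _) <;> assumption), fun y => ?_⟩) (lt_irrefl _)
  · cases t using Fin.cases with
    | zero => exact le_rfl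
    | succ t => exact hU _ _ _
  · cases hy : y 0 with
    | false =>
      obtain ⟨f, ⟨hfF, hfa⟩, hf⟩ := hs₀ (Fin.tail y)
      refine ⟨f, hfF, fun t => ?_⟩
      cases t using Fin.cases with
      | zero => simp [hy, hfa]
      | succ t =>
        rw [glueTree_succ, glueTree_succ, hy]
        exact hf t
    | true =>
      obtain ⟨f, ⟨hfF, hfa⟩, hf⟩ := hs₁ (Fin.tail y)
      refine ⟨f, hfF, fun t => ?_⟩
      cases t using Fin.cases with
      | zero =>
        simp only [hy, glueTree_zero, hfa, if_true]
        linarith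
      | succ t =>
        rw [glueTree_succ, glueTree_succ, hy]
        exact hf t

end Ordered

section Cover

variable {X : Type*} {n : ℕ}

/-- `G` has a sequential `γ`-cover on `x` listed, possibly with repetitions, by `N` trees. -/
def HasCover (G : Set (X → ℝ)) (γ : ℝ) (x : (Fin n → Bool) → Fin n → X) (N : ℕ) : Prop :=
  ∃ v : Fin N → (Fin n → Bool) → Fin n → ℝ, (∀ j, Predictable n (v j)) ∧
    ∀ f ∈ G, ∀ y, ∃ j, ∀ t, |v j y t - f (x y t)| ≤ γ

variable {G H : Set (X → ℝ)} {γ : ℝ} {x : (Fin n → Bool) → Fin n → X} {N M : ℕ}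

lemma hasCover_empty : HasCover ∅ γ x 0 :=
  ⟨fun j => j.elim0, fun j => j.elim0, fun _ hf => hf.elim⟩

lemma HasCover.subset (h : HasCover H γ x N) (hGH : G ⊆ H) : HasCover G γ x N :=
  let ⟨v, hv, hc⟩ := h
  ⟨v, hv, fun f hf => hc f (hGH hf)⟩

lemma HasCover.union (hG : HasCover G γ x N) (hH : HasCover H γ x M) :
    HasCover (G ∪ H) γ x (N + M) := by
  obtain ⟨v, hv, hvc⟩ := hG
  obtain ⟨w, hw, hwc⟩ := hH
  refine ⟨Fin.append v w, fun j => ?_, ?_⟩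
  · cases j using Fin.addCases with
    | left j => simpa using hv j
    | right j => simpa using hw j
  · rintro f (hf | hf) y
    · obtain ⟨j, hj⟩ := hvc f hf y
      exact ⟨Fin.castAdd M j, by simpa using hj⟩
    · obtain ⟨j, hj⟩ := hwc f hf y
      exact ⟨Fin.natAdd N j, by simpa using hj⟩

lemma HasCover.mono (h : HasCover G γ x N) (hNM : N ≤ M) : HasCover G γ x M := by
  obtain ⟨m, rfl⟩ := Nat.exists_eq_add_of_le hNM
  have hm : HasCover (∅ : Set (X → ℝ)) γ x m :=
    ⟨fun _ _ _ => 0, fun _ _ _ _ _ => rfl, fun _ hf => hf.elim⟩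
  exact (h.union hm).subset Set.subset_union_left

lemma HasCover.biUnion {ι : Type*} (S : Finset ι) {A : ι → Set (X → ℝ)}
    (h : ∀ i ∈ S, HasCover (A i) γ x N) : HasCover (⋃ i ∈ S, A i) γ x (S.card * N) := by
  classical
  induction S using Finset.induction_on with
  | empty => simpa using hasCover_empty
  | insert i S hi ih =>
    rw [Finset.card_insert_of_notMem hi, Finset.set_biUnion_insert, add_mul, one_mul,
      add_comm]
    exact (h i (Finset.mem_insert_self i S)).union
      (ih fun j hj => h j (Finset.mem_insert_of_mem hj))

lemma HasCover.of_subTree {x : (Fin (n + 1) → Bool) → Fin (n + 1) → X} (c : ℝ)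
    (hroot : ∀ f ∈ G, ∀ y, |c - f (x y 0)| ≤ γ)
    (h : ∀ b, HasCover G γ (subTree x b) N) : HasCover G γ x N := by
  choose v hv hc using h
  refine ⟨fun j => glueTree c fun b => v b j, fun j => .glueTree fun b => hv b j,
    fun f hf y => ?_⟩
  obtain ⟨j, hj⟩ := hc (y 0) f hf (Fin.tail y)
  refine ⟨j, fun t => ?_⟩
  cases t using Fin.cases with
  | zero => exact hroot f hf y
  | succ t => simpa only [glueTree_succ, subTree_apply_tail] using hj t

lemma HasCover.exists_isCoverOn (h : HasCover G γ x N) :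
    ∃ V : Finset ((Fin n → Bool) → Fin n → ℝ), IsCoverOn n G x γ V ∧ V.card ≤ N := by
  classical
  obtain ⟨v, hv, hc⟩ := h
  refine ⟨Finset.univ.image v, ⟨by simpa using hv, fun f hf y => ?_⟩, ?_⟩
  · obtain ⟨j, hj⟩ := hc f hf y
    exact ⟨v j, Finset.mem_image_of_mem v (Finset.mem_univ j), hj⟩
  · simpa using Finset.card_image_le (s := Finset.univ) (f := v)

end Cover

lemma sum_choose_mul_pow_succ (n e k : ℕ) :
    ∑ i ∈ Finset.range (e + 1), (n + 1).choose i * k ^ i =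
      ∑ i ∈ Finset.range (e + 1), n.choose i * k ^ i +
        k * ∑ i ∈ Finset.range e, n.choose i * k ^ i := by
  rw [Finset.sum_range_succ', Finset.sum_range_succ' (fun i => n.choose i * k ^ i),
    Finset.mul_sum, add_right_comm, ← Finset.sum_add_distrib]
  congr 1
  · refine Finset.sum_congr rfl fun i _ => ?_
    rw [Nat.choose_succ_succ]
    ring
  · simp

/-- A property of naturals that never holds at two values at distance at least `2` is
supported on two consecutive values. -/
lemma exists_le_forall_eq_or_eq_succ (k : ℕ) (P : ℕ → Prop)
    (hP : ∀ i j, i + 2 ≤ j → P i → ¬ P j) :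
    ∃ m ≤ k, ∀ i ≤ k, P i → i = m ∨ i = m + 1 := by
  classical
  by_cases h : ∃ i, i ≤ k ∧ P i
  · refine ⟨Nat.find h, (Nat.find_spec h).1, fun i hi hPi => ?_⟩
    have h₁ := Nat.find_min' h ⟨hi, hPi⟩
    have h₂ : ¬ Nat.find h + 2 ≤ i := fun hle => hP _ _ hle (Nat.find_spec h).2 hPi
    omega
  · exact ⟨0, Nat.zero_le k, fun i hi hPi => absurd ⟨i, hi, hPi⟩ h⟩

lemma OrderedDimLT.hasCover {X : Type*} [Preorder X] {k n : ℕ} {F : Set (X → ℝ)}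
    (hF : ∀ f ∈ F, ∀ x : X, ∃ m : ℕ, m ≤ k ∧ f x = m) {U : Set X} (hU : IsUpperSet U)
    {e : ℕ} (hdim : OrderedDimLT F U e) {x : (Fin n → Bool) → Fin n → X}
    (hx : Predictable n x) (hxo : OrderedTree n x) (hxU : ∀ y t, x y t ∈ U) :
    HasCover F (1 / 2) x (∑ i ∈ Finset.range e, n.choose i * k ^ i) := by
  induction n generalizing F U e with
  | zero =>
    cases e with
    | zero => simpa [hdim.eq_empty] using hasCover_empty
    | succ e =>
      have hone : HasCover F (1 / 2) x 1 :=
        ⟨fun _ _ _ => 0, fun _ _ _ _ _ => rfl, fun _ _ _ => ⟨0, fun t => t.elim0⟩⟩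
      refine hone.mono ?_
      rw [Finset.sum_range_succ']
      simp
  | succ n ih =>
    cases e with
    | zero => simpa [hdim.eq_empty] using hasCover_empty
    | succ e =>
      set a := x (fun _ => false) 0
      have hroot : ∀ y, x y 0 = a := fun y => hx.root_eq y _
      have hdim' : OrderedDimLT F (Set.Ici a) (e + 1) :=
        hdim.mono subset_rfl fun b hb => hU hb (hxU _ _)
      have hsub : ∀ b y t, subTree x b y t ∈ Set.Ici a := fun b y t => by
        rw [Set.mem_Ici, ← hroot (Fin.cons b y)]
        exact hxo.root_le _ _
      have cover : ∀ (G : Set (X → ℝ)) (e' : ℕ) (c : ℝ), G ⊆ F →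
          OrderedDimLT G (Set.Ici a) e' → (∀ f ∈ G, |c - f a| ≤ 1 / 2) →
          HasCover G (1 / 2) x (∑ i ∈ Finset.range e', n.choose i * k ^ i) :=
        fun G e' c hG hdG hc => .of_subTree c (fun f hf y => by simpa only [hroot] using hc f hf)
          fun b => ih (fun f hf => hF f (hG hf)) (isUpperSet_Ici a) hdG (hx.subTree b)
            (hxo.subTree b) (hsub b)
      obtain ⟨m, hmk, hm⟩ := exists_le_forall_eq_or_eq_succ k
        (fun i => ¬ OrderedDimLT {f ∈ F | f a = i} (Set.Ici a) e)
        fun i j hij hi hj => (hdim'.value_class hij).elim hi hj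
      have hmid := cover {f ∈ F | f a = m ∨ f a = m + 1} (e + 1) (m + 1 / 2)
        (Set.sep_subset _ _) (hdim'.mono (Set.sep_subset _ _) subset_rfl) (by
          rintro f ⟨-, hfa | hfa⟩ <;> rw [hfa, abs_le] <;> constructor <;> linarith)
      set S := ((Finset.range (k + 1)).erase m).erase (m + 1) with hS
      have hrest := HasCover.biUnion S fun i hi => by
        simp only [hS, Finset.mem_erase, Finset.mem_range] at hi
        refine cover {f ∈ F | f a = i} e i (Set.sep_subset _ _) ?_ ?_
        · by_contra hbig
          rcases hm i (by omega) hbig with h | h <;> omega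
        · rintro f ⟨-, hfa⟩
          norm_num [hfa]
      have hcard : S.card ≤ k := by
        refine (Finset.card_le_card (Finset.erase_subset _ _)).trans ?_
        rw [Finset.card_erase_of_mem (Finset.mem_range.2 (by omega)), Finset.card_range]
        omega
      rw [sum_choose_mul_pow_succ]
      refine ((hmid.union hrest).subset fun f hf => ?_).mono (by gcongr)
      obtain ⟨i, hik, hfa⟩ := hF f hf a
      by_cases him : i = m ∨ i = m + 1
      · exact .inl ⟨hf, by rw [hfa]; exact_mod_cast him⟩
      · refine .inr (Set.mem_biUnion (x := i) ?_ ⟨hf, hfa⟩)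
        simp only [hS, Finset.mem_coe, Finset.mem_erase, Finset.mem_range]
        omega

/-- ordered Vapnik–Chervonenkis–Sauer–Shelah lemma: if `F` is a class of
`{0,…,k}`-valued functions on a preordered set `X` and every ordered tree `2`-shattered by
`F` has depth at most `d`, then on any ordered tree `x` of depth `n > d` there is a
sequential `1/2`-cover of `F` of size at most `Σ_{i=0}^d C(n,i)·k^i`. -/
theorem stmt3 {X : Type*} [Preorder X] (k : ℕ) (hk : 1 ≤ k)
    (F : Set (X → ℝ)) (hF : ∀ f ∈ F, ∀ x : X, ∃ m : ℕ, m ≤ k ∧ f x = m)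
    (d : ℕ)
    (hdim : ∀ (D : ℕ) (x : (Fin D → Bool) → Fin D → X) (s : (Fin D → Bool) → Fin D → ℝ),
      OrderedTree D x → ShatteredBy F 2 D x s → D ≤ d)
    (n : ℕ) (hn : d < n)
    (x : (Fin n → Bool) → Fin n → X) (hx : Predictable n x) (hxo : OrderedTree n x) :
    ∃ V : Finset ((Fin n → Bool) → Fin n → ℝ),
      IsCoverOn n F x (1 / 2) V ∧
        V.card ≤ ∑ i ∈ Finset.range (d + 1), n.choose i * k ^ i := by
  exact (OrderedDimLT.hasCover (e := d + 1) hF isUpperSet_univ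
    (fun D x s hx _ hs => Nat.lt_succ_of_le (hdim D x s hx hs)) hx hxo
    fun _ _ => Set.mem_univ _).exists_isCoverOn
end

section
/- Let E be a real inner product space and let w, x ∈ E satisfy ‖w‖ < 1 and ‖x‖ ≤ 1 (so that ⟨w,x⟩ < 1). Let g = (1 − ⟨w,x⟩)^{-1} · x. Then for every z ∈ E, ⟨g, z⟩² ≤ 9 · ( 2‖z‖² / (1 − ‖w‖²) + 4⟨w,z⟩² / (1 − ‖w‖²)² ). In other words, the gradient g of the logarithmic loss w ↦ −log(1 − ⟨w,x⟩) has local norm at most 3 with respect to the Hessian of the self-concordant barrier R(w) = −log(1 − ‖w‖²). -/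
open scoped RealInnerProductSpace

/-- If `t² ≤ c a²`, then `(b + t)²` is controlled by a weighted Cauchy–Schwarz inequality. -/
theorem sq_add_mul_sq_le {a b c t δ : ℝ} (hδ : 0 < δ) (hc : 0 ≤ c) (ht : t ^ 2 ≤ c * a ^ 2) :
    (b + t) ^ 2 * δ ^ 2 ≤ ((δ + c) / 2) ^ 2 * (2 * a ^ 2 * δ + 4 * b ^ 2) := by
  have hcross : 2 * b * t * δ ≤ 2 * c * b ^ 2 + a ^ 2 * δ ^ 2 / 2 := by
    refine le_of_abs_le (abs_le_of_sq_le_sq ?_ (by positivity))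
    have h : 4 * (b * δ) ^ 2 * t ^ 2 ≤ 4 * (b * δ) ^ 2 * (c * a ^ 2) := by gcongr
    nlinarith [sq_nonneg (2 * c * b ^ 2 - a ^ 2 * δ ^ 2 / 2)]
  have h1 := mul_le_mul_of_nonneg_left hcross hδ.le
  have h2 := mul_le_mul_of_nonneg_left ht (sq_nonneg δ)
  have h3 : 0 ≤ c ^ 2 * (a ^ 2 * δ / 2 + b ^ 2) := by positivity
  linarith

/-- bounded local norm of the logarithmic loss gradient. Let `E` be a real
inner product space, `‖w‖ < 1`, `‖x‖ ≤ 1`, and `g = (1 − ⟨w,x⟩)⁻¹ • x`. Then for every `z`,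
`⟨g,z⟩² ≤ 9·(2‖z‖²/(1−‖w‖²) + 4⟨w,z⟩²/(1−‖w‖²)²)`, i.e. the dual local norm of `g` w.r.t.
the Hessian of `R(w) = −log(1−‖w‖²)` is at most `3`. -/
theorem stmt8 {E : Type*} [NormedAddCommGroup E] [InnerProductSpace ℝ E]
    (w x : E) (hw : ‖w‖ < 1) (hx : ‖x‖ ≤ 1)
    (g : E) (hg : g = (1 - ⟪w, x⟫)⁻¹ • x) (z : E) :
    ⟪g, z⟫ ^ 2 ≤ 9 * (2 * ‖z‖ ^ 2 / (1 - ‖w‖ ^ 2) + 4 * ⟪w, z⟫ ^ 2 / (1 - ‖w‖ ^ 2) ^ 2) := by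
  have hδ : 0 < 1 - ‖w‖ ^ 2 := by nlinarith [norm_nonneg w]
  have hxw : ‖x - w‖ ^ 2 ≤ 2 * (1 - ⟪w, x⟫) - (1 - ‖w‖ ^ 2) := by
    rw [norm_sub_sq_real, real_inner_comm]
    nlinarith [norm_nonneg x]
  have hc := (sq_nonneg ‖x - w‖).trans hxw
  have hd : 0 < 1 - ⟪w, x⟫ := by linarith
  have ht : ⟪x - w, z⟫ ^ 2 ≤ (2 * (1 - ⟪w, x⟫) - (1 - ‖w‖ ^ 2)) * ‖z‖ ^ 2 :=
    calc ⟪x - w, z⟫ ^ 2 ≤ (‖x - w‖ * ‖z‖) ^ 2 :=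
          sq_le_sq' (neg_le_of_abs_le (abs_real_inner_le_norm _ _)) (real_inner_le_norm _ _)
      _ = ‖x - w‖ ^ 2 * ‖z‖ ^ 2 := mul_pow _ _ _
      _ ≤ _ := by gcongr
  have key := sq_add_mul_sq_le (b := ⟪w, z⟫) hδ hc ht
  rw [← inner_add_left, add_sub_cancel, add_sub_cancel, mul_div_cancel_left₀ _ two_ne_zero] at key
  have hH : 0 ≤ 2 * ‖z‖ ^ 2 / (1 - ‖w‖ ^ 2) + 4 * ⟪w, z⟫ ^ 2 / (1 - ‖w‖ ^ 2) ^ 2 := by positivity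
  refine le_trans ?_ (le_mul_of_one_le_left hH (by norm_num : (1 : ℝ) ≤ 9))
  have hform : 2 * ‖z‖ ^ 2 / (1 - ‖w‖ ^ 2) + 4 * ⟪w, z⟫ ^ 2 / (1 - ‖w‖ ^ 2) ^ 2 =
      (2 * ‖z‖ ^ 2 * (1 - ‖w‖ ^ 2) + 4 * ⟪w, z⟫ ^ 2) / (1 - ‖w‖ ^ 2) ^ 2 := by
    field_simp
  rw [hg, real_inner_smul_left, mul_pow, inv_pow, inv_mul_le_iff₀ (by positivity), hform,
    ← mul_div_assoc, le_div_iff₀ (by positivity)]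
  exact key
end

section
/- Let d ≥ 1, let K ⊆ ℝ^d be a set, let x ∈ K, and let A be a symmetric positive definite d × d real matrix such that the Dikin ellipsoid is contained in K: for every u ∈ ℝ^d with uᵀ A u ≤ 1 one has x + u ∈ K. Let ψ : ℝ^d → ℝ be nonnegative on K, and let g ∈ ℝ^d satisfy the concavity (first-order) inequality ψ(y) ≤ ψ(x) + ⟨g, y − x⟩ for all y ∈ K. Then gᵀ A^{-1} g ≤ ψ(x)². -/
open Matrix

/-- Nesterov's lemma: let `K ⊆ ℝ^d`, `x ∈ K`, and let `A` be a symmetric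
positive definite matrix whose Dikin ellipsoid at `x` is contained in `K`. If `ψ` is
nonnegative on `K` and `g` satisfies the concavity first-order inequality
`ψ(y) ≤ ψ(x) + ⟨g, y − x⟩` on `K`, then `gᵀ A⁻¹ g ≤ ψ(x)²`. -/
theorem stmt9 (d : ℕ) (hd : 1 ≤ d) (K : Set (Fin d → ℝ)) (x : Fin d → ℝ) (hx : x ∈ K)
    (A : Matrix (Fin d) (Fin d) ℝ) (hA : A.PosDef)
    (hDikin : ∀ u : Fin d → ℝ, u ⬝ᵥ (A *ᵥ u) ≤ 1 → x + u ∈ K)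
    (ψ : (Fin d → ℝ) → ℝ) (hψ : ∀ y ∈ K, 0 ≤ ψ y)
    (g : Fin d → ℝ) (hconc : ∀ y ∈ K, ψ y ≤ ψ x + g ⬝ᵥ (y - x)) :
    g ⬝ᵥ (A⁻¹ *ᵥ g) ≤ ψ x ^ 2 := by
  set w := A⁻¹ *ᵥ g with hw
  rcases le_or_gt (g ⬝ᵥ w) 0 with hs | hs
  · exact hs.trans (sq_nonneg _)
  have hAw : A *ᵥ w = g := by
    rw [hw, mulVec_mulVec, mul_nonsing_inv A ((isUnit_iff_isUnit_det A).1 hA.isUnit), one_mulVec]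
  set r := √(g ⬝ᵥ w)
  have hr : 0 < r := Real.sqrt_pos.2 hs
  have hrs : g ⬝ᵥ w = r ^ 2 := (Real.sq_sqrt hs.le).symm
  have hu : x + (-r⁻¹) • w ∈ K := by
    apply hDikin
    rw [mulVec_smul, hAw, smul_dotProduct, dotProduct_smul, dotProduct_comm w g, hrs,
      smul_eq_mul, smul_eq_mul]
    apply le_of_eq
    field_simp
  have hle : 0 ≤ ψ x - r := by
    have h := (hψ _ hu).trans (hconc _ hu)
    rw [add_sub_cancel_left, dotProduct_smul, hrs, smul_eq_mul] at h
    have hmul : -r⁻¹ * r ^ 2 = -r := by field_simp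
    linarith
  rw [hrs]
  exact pow_le_pow_left₀ hr.le (sub_nonneg.1 hle) 2
end

section
/- Let n ≥ 1 and let X = ⋃_{t=0}^{n−1} {0,1}^t be the set of binary strings of length less than n. For b ∈ {0,1}^n define f_b : X → [1/4,1/2] by f_b(s) = 1/2 if s is a prefix of b (i.e. b_{1:|s|} = s) and f_b(s) = 1/4 otherwise, and let F = { f_b : b ∈ {0,1}^n }. Let x be the X-valued tree of depth n given by x_t(y) = (y_1,…,y_{t−1}). Then there exists a set V of at most n + 1 real-valued trees of depth n such that for every b ∈ {0,1}^n and every y ∈ {0,1}^n there is v ∈ V with v_t(y) = f_b(x_t(y)) for all t = 1,…,n; that is, F admits an exact (scale-0) sequential cover of size at most n + 1 on x. -/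
open scoped Classical

/-- The side-information set: binary strings of length less than `n`. -/
def Strs (n : ℕ) := {l : List Bool // l.length < n}

/-- The expert `f_b`: predicts `1/2` if the history is a prefix of `b`, and `1/4` otherwise. -/
noncomputable def fb (n : ℕ) (b : List Bool) : Strs n → ℝ :=
  fun s => if s.1 <+: b then 1 / 2 else 1 / 4

/-- The (unique consistent) tree of histories: `x_t(y) = (y_1,…,y_{t−1})`. -/
def histTree (n : ℕ) : (Fin n → Bool) → Fin n → Strs n :=
  fun y t => ⟨List.ofFn (fun s : Fin t.val => y ⟨s.val, s.isLt.trans t.isLt⟩),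
    by rw [List.length_ofFn]; exact t.isLt⟩

theorem histTree_val_eq_take (n : ℕ) (y : Fin n → Bool) (t : Fin n) :
    (histTree n y t).1 = (List.ofFn y).take t := by
  apply List.ext_getElem
  · simp [histTree, t.isLt.le]
  · intro i h₁ h₂
    simp [histTree]

/-- Agreement with `b` along the path `y` lasts exactly until some time `k ≤ n`. -/
theorem exists_histTree_prefix_iff_le (n : ℕ) (b : List Bool) (y : Fin n → Bool) :
    ∃ k ≤ n, ∀ t : Fin n, (histTree n y t).1 <+: b ↔ t.val ≤ k := by
  refine ⟨Nat.findGreatest (fun m => (List.ofFn y).take m <+: b) n,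
    Nat.findGreatest_le n, fun t => ?_⟩
  rw [histTree_val_eq_take]
  refine ⟨fun h => Nat.le_findGreatest t.isLt.le h, fun h => ?_⟩
  have hk := Nat.findGreatest_spec (P := fun m => (List.ofFn y).take m <+: b)
    (Nat.zero_le n) (by simp)
  exact (List.take_prefix_take_left h).trans hk

/-- The tree predicting `1/2` up to index `k` and `1/4` afterwards, on every path. -/
noncomputable def thresholdTree (n k : ℕ) : (Fin n → Bool) → Fin n → ℝ :=
  fun _ t => if t.val ≤ k then 1 / 2 else 1 / 4

/-- the class `F = {f_b : b ∈ {0,1}^n}` admits an exact (scale-0) sequential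
cover of size at most `n + 1` on the consistent-history tree `x_t(y) = (y_1,…,y_{t−1})`. -/
theorem stmt11 (n : ℕ) (hn : 1 ≤ n) :
    ∃ V : Finset ((Fin n → Bool) → Fin n → ℝ),
      (∀ v ∈ V, Predictable n v) ∧ V.card ≤ n + 1 ∧
      ∀ b : List Bool, b.length = n → ∀ y : Fin n → Bool,
        ∃ v ∈ V, ∀ t : Fin n, v y t = fb n b (histTree n y t) := by
  refine ⟨(Finset.range (n + 1)).image (thresholdTree n), ?_, ?_, ?_⟩
  · intro v hv
    obtain ⟨k, -, rfl⟩ := Finset.mem_image.mp hv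
    exact fun _ _ _ _ => rfl
  · exact Finset.card_image_le.trans_eq (Finset.card_range _)
  · intro b _ y
    obtain ⟨k, hk, h⟩ := exists_histTree_prefix_iff_le n b y
    refine ⟨thresholdTree n k,
      Finset.mem_image_of_mem _ (Finset.mem_range.mpr (Nat.lt_succ_of_le hk)), fun t => ?_⟩
    simp only [thresholdTree, fb, h t]
end

section
/- Let n ≥ 1 and let X = ⋃_{t=0}^{n−1} {0,1}^t. For b ∈ {0,1}^n define f_b : X → [1/4,1/2] by f_b(s) = 1/2 if s is a prefix of b and f_b(s) = 1/4 otherwise, and let F = { f_b : b ∈ {0,1}^n }. Define the distance d(f,g) = ( (1/n) Σ_{t=1}^n sup_{y_{1:t} ∈ {0,1}^t} ( ℓ(f(y_{1:t−1}), y_t) − ℓ(g(y_{1:t−1}), y_t) )² )^{1/2}, where ℓ(ŷ,y) = −1{y=1} log ŷ − 1{y=0} log(1−ŷ). Then there exists a subset S ⊆ F with |S| ≥ 2^{⌊n/2⌋} such that d(f,g) ≥ log(2)/√2 for all distinct f, g ∈ S. -/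
open scoped Classical

/-- The logarithmic loss `ℓ(a,y) = −1{y=1} log a − 1{y=0} log(1−a)` (real-valued; the
functions considered take values in `[1/4,1/2]`, where the loss is finite). -/
noncomputable def logLossR (a : ℝ) (y : Bool) : ℝ :=
  if y then -Real.log a else -Real.log (1 - a)

/-- The supremum-norm-type distance
`d(f,g) = ((1/n) Σ_{t=1}^n sup_{y_{1:t}} (ℓ(f(y_{1:t−1}),y_t) − ℓ(g(y_{1:t−1}),y_t))²)^{1/2}`. -/
noncomputable def supDist (n : ℕ) (f g : Strs n → ℝ) : ℝ :=
  Real.sqrt ((1 / n) * ∑ t : Fin n,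
    ⨆ w : Fin t.val → Bool, ⨆ c : Bool,
      (logLossR (f ⟨List.ofFn w, by rw [List.length_ofFn]; exact t.isLt⟩) c -
        logLossR (g ⟨List.ofFn w, by rw [List.length_ofFn]; exact t.isLt⟩) c) ^ 2)

theorem logLossR_half_sub_quarter_sq :
    (logLossR (1 / 2) true - logLossR (1 / 4) true) ^ 2 = Real.log 2 ^ 2 := by
  have h : Real.log (1 / 4) = -(2 * Real.log 2) := by
    rw [show (1 / 4 : ℝ) = ((2 : ℝ) ^ 2)⁻¹ by norm_num, Real.log_inv, Real.log_pow]
    norm_num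
  have h' : Real.log (1 / 2) = -Real.log 2 := by
    rw [one_div, Real.log_inv]
  simp only [logLossR, if_true, h, h']
  ring

theorem fb_take_eq_half {n t : ℕ} {b : List Bool} (h : (b.take t).length < n) :
    fb n b ⟨b.take t, h⟩ = 1 / 2 :=
  if_pos (List.take_prefix t b)

theorem fb_eq_quarter_of_take_ne {n k t : ℕ} {b b' : List Bool} (hb : b.length = n)
    (hkt : k ≤ t) (ht : t < n) (hne : b.take k ≠ b'.take k) (h : (b.take t).length < n) :
    fb n b' ⟨b.take t, h⟩ = 1 / 4 := by
  refine if_neg fun hp => hne ?_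
  have hp' : b.take t <+: b' := hp
  have h1 := List.prefix_iff_eq_take.mp hp'
  rw [List.length_take, hb, min_eq_left ht.le] at h1
  have h2 := congrArg (List.take k) h1
  rwa [List.take_take, List.take_take, min_eq_left hkt] at h2

theorem sq_le_iSup_logLossR {n : ℕ} (f g : Strs n → ℝ) (t : Fin n) (s : List Bool)
    (hs : s.length = t.val) (c : Bool) :
    (logLossR (f ⟨s, hs ▸ t.isLt⟩) c - logLossR (g ⟨s, hs ▸ t.isLt⟩) c) ^ 2 ≤
      ⨆ w : Fin t.val → Bool, ⨆ c : Bool,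
        (logLossR (f ⟨List.ofFn w, by rw [List.length_ofFn]; exact t.isLt⟩) c -
          logLossR (g ⟨List.ofFn w, by rw [List.length_ofFn]; exact t.isLt⟩) c) ^ 2 := by
  obtain ⟨t, ht⟩ := t
  dsimp only at hs
  subst hs
  refine le_ciSup_of_le (Set.finite_range _).bddAbove s.get ?_
  refine le_ciSup_of_le (Set.finite_range _).bddAbove c ?_
  simp only [List.ofFn_get, le_refl]

theorem supDist_fb_ge {n k : ℕ} {b b' : List Bool} (hb : b.length = n) (hkn : 2 * k ≤ n)
    (hn : 1 ≤ n) (hne : b.take k ≠ b'.take k) :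
    Real.log 2 / Real.sqrt 2 ≤ supDist n (fb n b) (fb n b') := by
  have hterm (t : Fin n) : (if k ≤ t.val then Real.log 2 ^ 2 else 0) ≤
      ⨆ w : Fin t.val → Bool, ⨆ c : Bool,
        (logLossR (fb n b ⟨List.ofFn w, by rw [List.length_ofFn]; exact t.isLt⟩) c -
          logLossR (fb n b' ⟨List.ofFn w, by rw [List.length_ofFn]; exact t.isLt⟩) c) ^ 2 := by
    split_ifs with hk
    · have hlen : (b.take t.val).length = t.val := by
        rw [List.length_take, hb, min_eq_left t.isLt.le]
      have h := sq_le_iSup_logLossR (fb n b) (fb n b') t (b.take t.val) hlen true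
      rw [fb_eq_quarter_of_take_ne hb hk t.isLt hne, fb_take_eq_half,
        logLossR_half_sub_quarter_sq] at h
      exact h
    · exact Real.iSup_nonneg fun w => Real.iSup_nonneg fun c => sq_nonneg _
  have hsum := Finset.sum_le_sum fun t (_ : t ∈ Finset.univ) => hterm t
  rw [Fin.sum_univ_eq_sum_range (fun t => if k ≤ t then Real.log 2 ^ 2 else 0) n,
    ← Finset.sum_filter, Finset.sum_const, nsmul_eq_mul,
    show (Finset.range n).filter (k ≤ ·) = Finset.Ico k n by ext; simp; omega,
    Nat.card_Ico, Nat.cast_sub (by omega)] at hsum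
  have hn' : (0 : ℝ) < n := by exact_mod_cast hn
  have hkn' : 2 * (k : ℝ) ≤ n := by exact_mod_cast hkn
  refine Real.le_sqrt_of_sq_le ?_
  rw [div_pow, Real.sq_sqrt (by norm_num)]
  calc Real.log 2 ^ 2 / 2 = 1 / n * ((n / 2) * Real.log 2 ^ 2) := by field_simp
    _ ≤ 1 / n * ((n - k) * Real.log 2 ^ 2) := by gcongr; linarith
    _ ≤ _ := by gcongr

theorem take_eq_of_fb_eq {n k : ℕ} {b b' : List Bool} (hb : b.length = n) (hk : k < n)
    (h : fb n b = fb n b') : b.take k = b'.take k := by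
  by_contra hne
  have hlen : (b.take k).length < n := by
    rw [List.length_take]
    omega
  have h1 := congrFun h ⟨b.take k, hlen⟩
  rw [fb_eq_quarter_of_take_ne hb le_rfl hk hne, fb_take_eq_half] at h1
  norm_num at h1

/-- the class `F = {f_b : b ∈ {0,1}^n}` contains at least `2^⌊n/2⌋` functions
at pairwise distance at least `log 2/√2` in the metric `d`. -/
theorem stmt12 (n : ℕ) (hn : 1 ≤ n) :
    ∃ S : Finset (Strs n → ℝ),
      (↑S : Set (Strs n → ℝ)) ⊆ {φ | ∃ b : List Bool, b.length = n ∧ φ = fb n b} ∧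
      2 ^ (n / 2) ≤ S.card ∧
      ∀ f ∈ S, ∀ g ∈ S, f ≠ g → Real.log 2 / Real.sqrt 2 ≤ supDist n f g := by
  set k := n / 2
  let e : (Fin k → Bool) → List Bool := fun u => List.ofFn u ++ List.replicate (n - k) false
  have he (u) : (e u).length = n := by
    simp only [e, List.length_append, List.length_ofFn, List.length_replicate]
    omega
  have htake (u) : (e u).take k = List.ofFn u := List.take_left' List.length_ofFn
  have hinj : Function.Injective fun u => fb n (e u) := fun u v huv => by
    have h := take_eq_of_fb_eq (k := k) (he u) (by omega) huv
    rwa [htake, htake, List.ofFn_inj] at h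
  refine ⟨Finset.univ.image fun u => fb n (e u), ?_, ?_, ?_⟩
  · intro φ hφ
    obtain ⟨u, -, rfl⟩ := Finset.mem_image.mp (Finset.mem_coe.mp hφ)
    exact ⟨e u, he u, rfl⟩
  · rw [Finset.card_image_of_injective _ hinj]
    simp
  · intro f hf g hg hfg
    obtain ⟨u, -, rfl⟩ := Finset.mem_image.mp hf
    obtain ⟨v, -, rfl⟩ := Finset.mem_image.mp hg
    refine supDist_fb_ge (k := k) (he u) (by omega) hn fun h => hfg ?_
    rw [htake, htake, List.ofFn_inj] at h
    rw [h]
end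

section
/- Let 0 < δ ≤ 1/2, let p ∈ [δ, 1−δ], let v ∈ [−1,1], and let λ > 0. Then p·exp(−λ v / p) + (1−p)·exp(λ v / (1−p)) ≤ exp( 2 v² δ · ( e^{λ/δ} − λ/δ − 1 ) ). Equivalently, the random variable X = η(p,y)·v with y ∼ Bernoulli(p) (i.e. X = −v/p with probability p and X = v/(1−p) with probability 1−p) satisfies E[e^{λX}] ≤ exp(2 v² δ · φ(λ/δ)) with φ(u) = e^u − u − 1. -/
theorem hasSum_exp_sub_sub_one (x : ℝ) :
    HasSum (fun n : ℕ => x ^ (n + 2) / ((n + 2).factorial : ℝ)) (Real.exp x - x - 1) := by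
  have h : HasSum (fun n : ℕ => x ^ n / (n.factorial : ℝ)) (Real.exp x) := by
    rw [Real.exp_eq_exp_ℝ]
    exact NormedSpace.expSeries_div_hasSum_exp x
  have h2 := (hasSum_nat_add_iff' 2).2 h
  have hs : Real.exp x - ∑ i ∈ Finset.range 2, x ^ i / (i.factorial : ℝ)
      = Real.exp x - x - 1 := by
    simp [Finset.sum_range_succ]
    ring
  rwa [hs] at h2

theorem sq_mul_exp_sub_sub_one_le {x c : ℝ} (h : |x| ≤ c) :
    c ^ 2 * (Real.exp x - x - 1) ≤ x ^ 2 * (Real.exp c - c - 1) := by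
  refine hasSum_le (fun n => ?_) ((hasSum_exp_sub_sub_one x).mul_left (c ^ 2))
    ((hasSum_exp_sub_sub_one c).mul_left (x ^ 2))
  have hn : x ^ n ≤ c ^ n :=
    (le_abs_self _).trans (by rw [abs_pow]; gcongr)
  calc c ^ 2 * (x ^ (n + 2) / ((n + 2).factorial : ℝ))
      = x ^ 2 * c ^ 2 * x ^ n / ((n + 2).factorial : ℝ) := by ring
    _ ≤ x ^ 2 * c ^ 2 * c ^ n / ((n + 2).factorial : ℝ) := by gcongr
    _ = x ^ 2 * (c ^ (n + 2) / ((n + 2).factorial : ℝ)) := by ring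

theorem abs_mul_div_le_div {δ q l v : ℝ} (hδ : 0 < δ) (hq : δ ≤ q) (hl : 0 ≤ l)
    (hv : |v| ≤ 1) : |l * v / q| ≤ l / δ := by
  rw [abs_div, abs_mul, abs_of_nonneg hl, abs_of_pos (hδ.trans_le hq)]
  gcongr
  exact mul_le_of_le_one_right hl hv


/-- the Bernstein-type moment-generating-function bound. For `0 < δ ≤ 1/2`,
`p ∈ [δ,1−δ]`, `v ∈ [−1,1]` and `λ > 0`,
`p·exp(−λv/p) + (1−p)·exp(λv/(1−p)) ≤ exp(2v²δ·(e^{λ/δ} − λ/δ − 1))`. -/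
theorem stmt15 (δ : ℝ) (hδ0 : 0 < δ) (hδ : δ ≤ 1 / 2)
    (p : ℝ) (hp : p ∈ Set.Icc δ (1 - δ)) (v : ℝ) (hv : v ∈ Set.Icc (-1 : ℝ) 1)
    (l : ℝ) (hl : 0 < l) :
    p * Real.exp (-l * v / p) + (1 - p) * Real.exp (l * v / (1 - p)) ≤
      Real.exp (2 * v ^ 2 * δ * (Real.exp (l / δ) - l / δ - 1)) := by
  obtain ⟨hp1, hp2⟩ := hp
  have hv' : |v| ≤ 1 := abs_le.2 hv
  have hp0 : 0 < p := by linarith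
  have hq0 : 0 < 1 - p := by linarith
  have hq1 : δ ≤ 1 - p := by linarith
  have hx : |-l * v / p| ≤ l / δ := by
    rw [neg_mul, neg_div, abs_neg]
    exact abs_mul_div_le_div hδ0 hp1 hl.le hv'
  have hx' := sq_mul_exp_sub_sub_one_le hx
  have hy' := sq_mul_exp_sub_sub_one_le (abs_mul_div_le_div hδ0 hq1 hl.le hv')
  have hc : 0 < l / δ := by positivity
  have hφ : 0 ≤ Real.exp (l / δ) - l / δ - 1 := by
    linarith [Real.add_one_le_exp (l / δ)]
  have hmean : p * (-l * v / p) + (1 - p) * (l * v / (1 - p)) = 0 := by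
    field_simp
    ring
  have hvar : p * (-l * v / p) ^ 2 + (1 - p) * (l * v / (1 - p)) ^ 2 ≤
      (l / δ) ^ 2 * (2 * v ^ 2 * δ) := by
    have hpq : δ / 2 ≤ p * (1 - p) := by nlinarith
    calc p * (-l * v / p) ^ 2 + (1 - p) * (l * v / (1 - p)) ^ 2
        = l ^ 2 * v ^ 2 / (p * (1 - p)) := by
          field_simp
          ring
      _ ≤ l ^ 2 * v ^ 2 / (δ / 2) := by gcongr
      _ = (l / δ) ^ 2 * (2 * v ^ 2 * δ) := by
          field_simp
  generalize -l * v / p = x at *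
  generalize l * v / (1 - p) = y at *
  generalize l / δ = c at *
  refine le_trans ?_ (Real.add_one_le_exp _)
  refine le_of_mul_le_mul_left ?_ (pow_pos hc 2)
  have h1 := mul_le_mul_of_nonneg_left hx' hp0.le
  have h2 := mul_le_mul_of_nonneg_left hy' hq0.le
  have h3 := mul_le_mul_of_nonneg_right hvar hφ
  have h4 : c ^ 2 * (p * x + (1 - p) * y) = 0 := by rw [hmean, mul_zero]
  linarith
end

section
/- Let 0 < δ ≤ 1/2, let p ∈ [δ, 1−δ], let v ∈ [−1,1], let c > 0, and set λ = δ·log(1 + c/2). Then p·exp( λ(−v/p − c v²) ) + (1−p)·exp( λ(v/(1−p) − c v²) ) ≤ 1. Equivalently, with y ∼ Bernoulli(p), E[ exp( λ(η(p,y)·v − c v²) ) ] ≤ 1. -/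
/-- A scaling form of the second-order bound on the exponential:
`(exp x - 1 - x) / x²` at `x = t * L`, `|t| ≤ 1`, is at most its value at `L ≥ 0`. -/
theorem exp_mul_le_one_add_add_sq_mul {t L : ℝ} (ht : |t| ≤ 1) (hL : 0 ≤ L) :
    Real.exp (t * L) ≤ 1 + t * L + t ^ 2 * (Real.exp L - 1 - L) := by
  have hexp (x : ℝ) : HasSum (fun n : ℕ => x ^ n / (n.factorial : ℝ)) (Real.exp x) := by
    rw [Real.exp_eq_exp_ℝ]
    exact NormedSpace.expSeries_div_hasSum_exp x
  have hdiff := (hexp (t * L)).sub ((hexp L).mul_left (t ^ 2))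
  have htail : ∀ n ∉ Finset.range 2,
      (t * L) ^ n / (n.factorial : ℝ) - t ^ 2 * (L ^ n / (n.factorial : ℝ)) ≤ 0 := by
    intro n hn
    obtain ⟨k, rfl⟩ : ∃ k, n = k + 2 :=
      ⟨n - 2, by simp only [Finset.mem_range] at hn; omega⟩
    have hk : t ^ k ≤ 1 := (le_abs_self _).trans (by
      rw [abs_pow]; exact pow_le_one₀ (abs_nonneg t) ht)
    have hpos : 0 ≤ t ^ 2 * (L ^ (k + 2) / ((k + 2).factorial : ℝ)) := by positivity
    calc (t * L) ^ (k + 2) / ((k + 2).factorial : ℝ) -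
          t ^ 2 * (L ^ (k + 2) / ((k + 2).factorial : ℝ))
        = (t ^ k - 1) * (t ^ 2 * (L ^ (k + 2) / ((k + 2).factorial : ℝ))) := by ring
      _ ≤ 0 := mul_nonpos_of_nonpos_of_nonneg (by linarith) hpos
  have hle := sum_le_hasSum (Finset.range 2)
    (fun n hn => neg_nonneg.2 (htail n hn)) hdiff.neg
  norm_num [Finset.sum_range_succ] at hle
  linarith

theorem exp_sub_one_sub_le_mul (L : ℝ) :
    Real.exp L - 1 - L ≤ L * (Real.exp L - 1) := by
  have h := Real.one_sub_le_exp_neg L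
  have h' := mul_le_mul_of_nonneg_right h (Real.exp_pos L).le
  rw [← Real.exp_add, neg_add_cancel, Real.exp_zero] at h'
  linarith

/-- One branch of the two-point moment generating function, with probability `q ≥ δ`. -/
theorem mul_exp_div_le {δ q v L : ℝ} (hδ : 0 < δ) (hq : δ ≤ q) (hv : |v| ≤ 1) (hL : 0 ≤ L) :
    q * Real.exp (δ * L * v / q) ≤ q + δ * L * v + δ * v ^ 2 * (Real.exp L - 1 - L) := by
  have hq0 : 0 < q := hδ.trans_le hq
  have ht : |δ / q * v| ≤ 1 := by
    rw [abs_mul, abs_of_pos (div_pos hδ hq0)]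
    exact mul_le_one₀ ((div_le_one hq0).2 hq) (abs_nonneg v) hv
  have hK : 0 ≤ Real.exp L - 1 - L := by linarith [Real.add_one_le_exp L]
  have hδq : δ ^ 2 / q ≤ δ := by
    rw [div_le_iff₀ hq0, sq]
    exact mul_le_mul_of_nonneg_left hq hδ.le
  calc q * Real.exp (δ * L * v / q) = q * Real.exp (δ / q * v * L) := by ring_nf
    _ ≤ q * (1 + δ / q * v * L + (δ / q * v) ^ 2 * (Real.exp L - 1 - L)) :=
        mul_le_mul_of_nonneg_left (exp_mul_le_one_add_add_sq_mul ht hL) hq0.le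
    _ = q + δ * L * v + δ ^ 2 / q * (v ^ 2 * (Real.exp L - 1 - L)) := by
        field_simp
    _ ≤ q + δ * L * v + δ * (v ^ 2 * (Real.exp L - 1 - L)) := by gcongr
    _ = q + δ * L * v + δ * v ^ 2 * (Real.exp L - 1 - L) := by ring


/-- the one-step supermartingale bound. For `0 < δ ≤ 1/2`, `p ∈ [δ,1−δ]`,
`v ∈ [−1,1]`, `c > 0` and `λ = δ·log(1 + c/2)`,
`p·exp(λ(−v/p − cv²)) + (1−p)·exp(λ(v/(1−p) − cv²)) ≤ 1`. -/
theorem stmt17 (δ : ℝ) (hδ0 : 0 < δ) (hδ : δ ≤ 1 / 2)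
    (p : ℝ) (hp : p ∈ Set.Icc δ (1 - δ)) (v : ℝ) (hv : v ∈ Set.Icc (-1 : ℝ) 1)
    (c : ℝ) (hc : 0 < c) (l : ℝ) (hl : l = δ * Real.log (1 + c / 2)) :
    p * Real.exp (l * (-v / p - c * v ^ 2)) +
      (1 - p) * Real.exp (l * (v / (1 - p) - c * v ^ 2)) ≤ 1 := by
  obtain ⟨hp1, hp2⟩ := hp
  set L := Real.log (1 + c / 2)
  have hL : 0 ≤ L := Real.log_nonneg (by linarith)
  have hexpL : Real.exp L = 1 + c / 2 := Real.exp_log (by linarith)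
  have hv' : |v| ≤ 1 := abs_le.2 hv
  have h₁ := mul_exp_div_le (v := -v) hδ0 hp1 (by rwa [abs_neg]) hL
  have h₂ := mul_exp_div_le hδ0 (show δ ≤ 1 - p by linarith) hv' hL
  have hK := mul_le_mul_of_nonneg_left (exp_sub_one_sub_le_mul L)
    (show 0 ≤ 2 * δ * v ^ 2 by positivity)
  have hsum : p * Real.exp (δ * L * -v / p) + (1 - p) * Real.exp (δ * L * v / (1 - p)) ≤
      Real.exp (l * (c * v ^ 2)) := by
    refine le_trans ?_ (Real.add_one_le_exp _)
    rw [hexpL] at h₁ h₂ hK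
    rw [hl]
    linarith
  calc p * Real.exp (l * (-v / p - c * v ^ 2)) +
        (1 - p) * Real.exp (l * (v / (1 - p) - c * v ^ 2))
      = (p * Real.exp (δ * L * -v / p) + (1 - p) * Real.exp (δ * L * v / (1 - p))) /
          Real.exp (l * (c * v ^ 2)) := by
        rw [mul_sub, mul_sub, Real.exp_sub, Real.exp_sub, hl, mul_div_assoc (δ * L) (-v),
          mul_div_assoc (δ * L) v]
        ring
    _ ≤ 1 := (div_le_one (Real.exp_pos _)).2 hsum
end

section
/- Let n ≥ 2 be an integer. For every real z with 1/n ≤ z ≤ 1, −log z ≤ −2z + 1 + log 2 + 4(log n)·(z − 1/2)². Equivalently, the remainder in the expansion ℓ(1/2,1) − ℓ(z,1) = 2(z − 1/2) − R(z) of the logarithmic loss around 1/2 satisfies R(z) ≤ 4(log n)(z − 1/2)² on [1/n, 1]. -/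
lemma neg_log_le_inv_sqrt_sub_sqrt {u : ℝ} (h0 : 0 < u) (h1 : u ≤ 1) :
    -Real.log u ≤ (√u)⁻¹ - √u := by
  have hs : 0 < √u := Real.sqrt_pos.2 h0
  have h := Real.self_le_sinh_iff.2 (show 0 ≤ -Real.log √u by
    rw [Real.log_sqrt h0.le]
    linarith [Real.log_nonpos h0.le h1])
  rw [Real.sinh_eq, neg_neg, Real.exp_neg, Real.exp_log hs, Real.log_sqrt h0.le] at h
  linarith

lemma sub_one_sub_log_le_of_one_le {u : ℝ} (h1 : 1 ≤ u) :
    u - 1 - Real.log u ≤ (u - 1) ^ 2 / 2 := by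
  have h := Real.le_log_one_add_of_nonneg (sub_nonneg.2 h1)
  rw [add_sub_cancel] at h
  have h2 : u - 1 - (u - 1) ^ 2 / 2 ≤ 2 * (u - 1) / (u - 1 + 2) := by
    rw [le_div_iff₀ (by linarith)]
    nlinarith [mul_nonneg (sq_nonneg (u - 1)) (sub_nonneg.2 h1)]
  linarith

lemma sub_one_sub_log_le_of_le_one {u b : ℝ} (h0 : 0 < u) (h1 : u ≤ 1) (hb : 1 / 2 ≤ b) :
    u - 1 - Real.log u ≤ (b - Real.log u) * (u - 1) ^ 2 := by
  have h := neg_log_le_inv_sqrt_sub_sqrt h0 h1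
  have hs : 0 < √u := Real.sqrt_pos.2 h0
  have hs1 : √u ≤ 1 := Real.sqrt_le_one.2 h1
  have hu : √u ^ 2 = u := Real.sq_sqrt h0.le
  set s := √u
  have h2 : -Real.log u * (u * (2 - u)) ≤ (s⁻¹ - s) * (u * (2 - u)) :=
    mul_le_mul_of_nonneg_right h (mul_nonneg h0.le (by linarith))
  have h3 : (s⁻¹ - s) * (u * (2 - u)) = (1 - u) * (s * (2 - u)) := by
    rw [← hu]
    field_simp
  have h4 : s * (2 - u) ≤ 1 + b * (1 - u) := by
    have h5 : 0 ≤ (1 - s) * ((b - 1 / 2) * (1 + s) + (1 - s) * (s + 3 / 2)) := by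
      have := sub_nonneg.2 hs1
      have := sub_nonneg.2 hb
      positivity
    rw [← hu]
    nlinarith
  nlinarith [mul_le_mul_of_nonneg_left h4 (sub_nonneg.2 h1)]

/-- for an integer `n ≥ 2` and `z ∈ [1/n, 1]`,
`−log z ≤ −2z + 1 + log 2 + 4(log n)(z − 1/2)²`. -/
theorem stmt18 (n : ℕ) (hn : 2 ≤ n) (z : ℝ) (hz1 : 1 / (n : ℝ) ≤ z) (hz2 : z ≤ 1) :
    -Real.log z ≤ -2 * z + 1 + Real.log 2 + 4 * Real.log n * (z - 1 / 2) ^ 2 := by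
  have hn2 : (2 : ℝ) ≤ n := by exact_mod_cast hn
  have hn0 : (0 : ℝ) < n := by linarith
  have hz0 : 0 < z := lt_of_lt_of_le (by positivity) hz1
  have hlog : Real.log (2 * z) = Real.log 2 + Real.log z :=
    Real.log_mul two_ne_zero hz0.ne'
  have hlog2 : 1 / 2 ≤ Real.log 2 := by linarith [Real.log_two_gt_d9]
  suffices h : 2 * z - 1 - Real.log (2 * z) ≤ Real.log n * (2 * z - 1) ^ 2 by
    rw [hlog] at h
    linarith
  rcases le_total (2 * z) 1 with h1 | h1
  · refine (sub_one_sub_log_le_of_le_one (by linarith) h1 hlog2).trans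
      (mul_le_mul_of_nonneg_right ?_ (sq_nonneg _))
    have h := Real.log_le_log (by positivity) hz1
    rw [one_div, Real.log_inv] at h
    linarith
  · have h := Real.log_le_log two_pos hn2
    nlinarith [sub_one_sub_log_le_of_one_le h1, sq_nonneg (2 * z - 1)]
end

section
/- For all real numbers a and b with 0 ≤ a < 1 and −1 ≤ b ≤ 1, one has b²(1−a)²/(1−ab)² + (1−b²)(1−a)/(1−ab)² ≤ 3. -/
/-- for `0 ≤ a < 1` and `−1 ≤ b ≤ 1`,
`b²(1−a)²/(1−ab)² + (1−b²)(1−a)/(1−ab)² ≤ 3`. -/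
theorem stmt19 (a b : ℝ) (ha0 : 0 ≤ a) (ha1 : a < 1) (hb1 : -1 ≤ b) (hb2 : b ≤ 1) :
    b ^ 2 * (1 - a) ^ 2 / (1 - a * b) ^ 2 + (1 - b ^ 2) * (1 - a) / (1 - a * b) ^ 2 ≤ 3 := by
  have hab : 0 < 1 - a * b := by nlinarith [mul_le_mul_of_nonneg_left hb2 ha0]
  rw [← add_div, div_le_iff₀ (pow_pos hab 2)]
  linear_combination mul_nonneg ha0 (sq_nonneg (1 - b)) + 2 * sq_nonneg (1 - a * b)
end
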